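/- arXiv:2206.12982 — 8 statements merged into one kernel-verified Lean document; each statement's English description precedes it below -/
import Mathlib

section
/- Let R = ℂ[x,y]⟨Y,Z,W⟩ and let I₂ ⊆ R be the two-sided ideal generated by the thirteen elements (x²−y)(x²−y+2)(x²−y+4), (x²−y+4)Y, (x²−y+4)Z, (x²−y+4)W, Y²−Y, Z², W², ZY, YW, ZW−Y, YZ−ZY−Z, YW−WY+W, and ZW−WZ+(1/8)(x²−y)(x²−y+2)−2Y. Then the quotient algebra R/I₂ is isomorphic as a ℂ-algebra to ℂ[t] × ℂ[t] × M₂(ℂ[t]). -/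
noncomputable section
open MvPolynomial

/-- `R = ℂ[x,y]⟨Y,Z,W⟩`: the ℂ-algebra generated by two central elements `x, y`
and three noncommuting elements `Y, Z, W`, realized as the free associative
algebra over the polynomial ring `ℂ[x,y]` on three generators. -/
abbrev RAlg : Type := FreeAlgebra (MvPolynomial (Fin 2) ℂ) (Fin 3)

def cx : RAlg := algebraMap (MvPolynomial (Fin 2) ℂ) RAlg (X 0)
def cy : RAlg := algebraMap (MvPolynomial (Fin 2) ℂ) RAlg (X 1)
def gY : RAlg := FreeAlgebra.ι (MvPolynomial (Fin 2) ℂ) (0 : Fin 3)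
def gZ : RAlg := FreeAlgebra.ι (MvPolynomial (Fin 2) ℂ) (1 : Fin 3)
def gW : RAlg := FreeAlgebra.ι (MvPolynomial (Fin 2) ℂ) (2 : Fin 3)

/-- The two-sided ideal `I₂` generated by the thirteen listed elements. -/
def I2 : TwoSidedIdeal RAlg := TwoSidedIdeal.span
  { (cx ^ 2 - cy) * (cx ^ 2 - cy + 2) * (cx ^ 2 - cy + 4),
    (cx ^ 2 - cy + 4) * gY, (cx ^ 2 - cy + 4) * gZ, (cx ^ 2 - cy + 4) * gW,
    gY ^ 2 - gY, gZ ^ 2, gW ^ 2, gZ * gY, gY * gW, gZ * gW - gY,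
    gY * gZ - gZ * gY - gZ, gY * gW - gW * gY + gW,
    gZ * gW - gW * gZ + (8⁻¹ : ℂ) • ((cx ^ 2 - cy) * (cx ^ 2 - cy + 2)) - 2 * gY }


/-- A ℂ-algebra homomorphism out of `RAlg` with prescribed values on the generators, where
`x` and `y` are sent to central elements. -/
theorem RAlg.exists_algHom {T : Type*} [Ring T] [Algebra ℂ T]
    (a b : Subalgebra.center ℂ T) (p q r : T) :
    ∃ f : RAlg →ₐ[ℂ] T, f cx = a ∧ f cy = b ∧ f gY = p ∧ f gZ = q ∧ f gW = r := by
  let φ : MvPolynomial (Fin 2) ℂ →ₐ[ℂ] T :=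
    (Subalgebra.center ℂ T).val.comp (MvPolynomial.aeval ![a, b])
  let : Algebra (MvPolynomial (Fin 2) ℂ) T := φ.toRingHom.toAlgebra' fun c t ↦
    (Subalgebra.mem_center_iff.mp (MvPolynomial.aeval ![a, b] c).2 t).symm
  have hφ (c) : algebraMap (MvPolynomial (Fin 2) ℂ) T c = φ c := rfl
  have : IsScalarTower ℂ (MvPolynomial (Fin 2) ℂ) T :=
    IsScalarTower.of_algebraMap_eq fun z ↦ (φ.commutes z).symm
  refine ⟨(FreeAlgebra.lift (MvPolynomial (Fin 2) ℂ) ![p, q, r]).restrictScalars ℂ, ?_⟩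
  simp [cx, cy, gY, gZ, gW, hφ, φ]

/-- ℂ-algebra homomorphisms out of `RAlg` are determined by their values on the generators. -/
theorem RAlg.algHom_ext {T : Type*} [Ring T] [Algebra ℂ T] {f g : RAlg →ₐ[ℂ] T}
    (hx : f cx = g cx) (hy : f cy = g cy) (hY : f gY = g gY) (hZ : f gZ = g gZ)
    (hW : f gW = g gW) : f = g := by
  have hc : f.comp (IsScalarTower.toAlgHom ℂ (MvPolynomial (Fin 2) ℂ) RAlg) =
      g.comp (IsScalarTower.toAlgHom ℂ (MvPolynomial (Fin 2) ℂ) RAlg) := by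
    ext i
    fin_cases i
    · exact hx
    · exact hy
  ext r
  induction r using FreeAlgebra.induction with
  | grade0 c => exact DFunLike.congr_fun hc c
  | grade1 i =>
    fin_cases i
    · exact hY
    · exact hZ
    · exact hW
  | mul a b ha hb => rw [map_mul, map_mul, ha, hb]
  | add a b ha hb => rw [map_add, map_add, ha, hb]

theorem Commute.aeval_left {Q : Type*} [Ring Q] [Algebra ℂ Q] {x e : Q} (h : Commute x e)
    (p : Polynomial ℂ) : Commute (Polynomial.aeval x p) e := by
  induction p using Polynomial.induction_on' with
  | add p q hp hq => rw [map_add]; exact hp.add_left hq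
  | monomial n a =>
    rw [Polynomial.aeval_monomial]
    exact (Algebra.commute_algebraMap_left a e).mul_left (h.pow_left n)

/-- Orthogonal idempotents `e₀`, `e₁` together with a complementary system `E` of `2 × 2` matrix
units, all commuting with `x`, induce a homomorphism from `ℂ[t] × ℂ[t] × M₂(ℂ[t])`. -/
theorem exists_algHom_of_matrixUnits {Q : Type*} [Ring Q] [Algebra ℂ Q] (x e₀ e₁ : Q)
    (E : Fin 2 → Fin 2 → Q) (hx₀ : Commute x e₀) (hx₁ : Commute x e₁)
    (hxE : ∀ i j, Commute x (E i j)) (h₀₀ : e₀ * e₀ = e₀) (h₀₁ : e₀ * e₁ = 0)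
    (h₁₀ : e₁ * e₀ = 0) (h₁₁ : e₁ * e₁ = e₁) (h₀E : ∀ i j, e₀ * E i j = 0)
    (hE₀ : ∀ i j, E i j * e₀ = 0) (h₁E : ∀ i j, e₁ * E i j = 0) (hE₁ : ∀ i j, E i j * e₁ = 0)
    (hEE : ∀ i j k l, E i j * E k l = if j = k then E i l else 0)
    (hone : e₀ + e₁ + (E 0 0 + E 1 1) = 1) :
    ∃ g : (Polynomial ℂ × Polynomial ℂ × Matrix (Fin 2) (Fin 2) (Polynomial ℂ)) →ₐ[ℂ] Q,
      ∀ t, g t = Polynomial.aeval x t.1 * e₀ + Polynomial.aeval x t.2.1 * e₁ +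
        ∑ i, ∑ j, Polynomial.aeval x (t.2.2 i j) * E i j := by
  have mul_mul {e : Q} (he : Commute x e) (p q : Polynomial ℂ) (e' : Q) :
      Polynomial.aeval x p * e * (Polynomial.aeval x q * e') =
        Polynomial.aeval x (p * q) * (e * e') := by
    rw [map_mul, mul_assoc, ← mul_assoc e, ← (he.aeval_left q).eq]
    simp only [mul_assoc]
  refine ⟨AlgHom.ofLinearMap
    { toFun t := Polynomial.aeval x t.1 * e₀ + Polynomial.aeval x t.2.1 * e₁ +
        ∑ i, ∑ j, Polynomial.aeval x (t.2.2 i j) * E i j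
      map_add' s t := ?_
      map_smul' c t := ?_ } ?_ ?_, fun t ↦ rfl⟩
  · simp only [Fin.sum_univ_two, Prod.fst_add, Prod.snd_add, Matrix.add_apply, map_add, add_mul]
    abel
  · simp [Fin.sum_univ_two, Matrix.smul_apply]
  · simpa using hone
  · intro s t
    simp only [LinearMap.coe_mk, AddHom.coe_mk, Fin.sum_univ_two, mul_add, add_mul,
      mul_mul hx₀, mul_mul hx₁, mul_mul (hxE _ _), h₀₀, h₀₁, h₁₀, h₁₁, h₀E, hE₀, h₁E, hE₁, hEE,
      Prod.fst_mul, Prod.snd_mul, Matrix.mul_apply, map_add]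
    simp
    abel

/-- Elements of a ℂ-algebra satisfying the relations of `I2`, with `x` and `u = x ^ 2 - y`
commuting with the others, induce a homomorphism from `ℂ[t] × ℂ[t] × M₂(ℂ[t])`. -/
theorem exists_algHom_of_relations {Q : Type*} [Ring Q] [Algebra ℂ Q] (x u Y Z W : Q)
    (hxu : Commute x u) (hxY : Commute x Y) (hxZ : Commute x Z) (hxW : Commute x W)
    (huY : Commute u Y) (huZ : Commute u Z) (huW : Commute u W)
    (hu : u * (u + 2) * (u + 4) = 0) (uY : (u + 4) * Y = 0) (uZ : (u + 4) * Z = 0)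
    (uW : (u + 4) * W = 0) (YY : Y ^ 2 - Y = 0) (ZZ : Z ^ 2 = 0) (WW : W ^ 2 = 0)
    (ZY : Z * Y = 0) (YW : Y * W = 0) (ZW : Z * W - Y = 0) (YZ : Y * Z - Z * Y - Z = 0)
    (WY : Y * W - W * Y + W = 0)
    (WZ : Z * W - W * Z + (8⁻¹ : ℂ) • (u * (u + 2)) - 2 * Y = 0) :
    ∃ g : (Polynomial ℂ × Polynomial ℂ × Matrix (Fin 2) (Fin 2) (Polynomial ℂ)) →ₐ[ℂ] Q,
      g (Polynomial.X, Polynomial.X, Matrix.scalar _ Polynomial.X) = x ∧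
      g (Polynomial.X ^ 2, Polynomial.X ^ 2 + 2, Matrix.scalar _ (Polynomial.X ^ 2 + 4)) =
        x ^ 2 - u ∧
      g (0, 0, Matrix.single 0 0 1) = Y ∧ g (0, 0, Matrix.single 0 1 1) = Z ∧
      g (0, 0, Matrix.single 1 0 1) = W := by
  let P : Polynomial ℂ →ₐ[ℂ] Q := Polynomial.aeval u
  let c : Polynomial ℂ := Polynomial.C 8⁻¹
  have hc : c * 8 = 1 := by
    rw [← map_ofNat Polynomial.C 8, ← Polynomial.C_mul]
    norm_num
  have hPX : P Polynomial.X = u := Polynomial.aeval_X u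
  have P_eq {p q : Polynomial ℂ} (r : Polynomial ℂ)
      (h : p - q = r * (Polynomial.X * (Polynomial.X + 2) * (Polynomial.X + 4))) : P p = P q := by
    rw [← sub_eq_zero, ← map_sub, h]
    simp [hPX, hu, map_ofNat P]
  have P_mul_eq {e : Q} (he : (u + 4) * e = 0) {p q : Polynomial ℂ} (r : Polynomial ℂ)
      (h : p - q = r * (Polynomial.X + 4)) : P p * e = P q * e := by
    rw [← sub_eq_zero, ← sub_mul, ← map_sub, h]
    simp [hPX, mul_assoc, he, map_ofNat P]
  let p₀ : Polynomial ℂ := c * ((Polynomial.X + 2) * (Polynomial.X + 4))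
  let p₁ : Polynomial ℂ := -(2 * c) * (Polynomial.X * (Polynomial.X + 4))
  let p₂ : Polynomial ℂ := c * (Polynomial.X * (Polynomial.X + 2))
  have hp₂ : P p₂ = (8⁻¹ : ℂ) • (u * (u + 2)) := by
    have hPc : P c = algebraMap ℂ Q 8⁻¹ := Polynomial.aeval_C u _
    simp [p₂, hPX, hPc, map_ofNat P, Algebra.smul_def]
  have h₀₀ : P p₀ * P p₀ = P p₀ := by
    rw [← map_mul]
    refine P_eq (c ^ 2 * (Polynomial.X + 6)) ?_
    linear_combination c * (Polynomial.X + 2) * (Polynomial.X + 4) * hc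
  have h₀₁ : P p₀ * P p₁ = 0 := by
    rw [← map_mul, ← map_zero P]
    exact P_eq (-2 * c ^ 2 * (Polynomial.X + 4)) (by ring)
  have h₁₁ : P p₁ * P p₁ = P p₁ := by
    rw [← map_mul]
    refine P_eq (4 * c ^ 2 * (Polynomial.X + 2)) ?_
    linear_combination -2 * c * Polynomial.X * (Polynomial.X + 4) * hc
  have h₀₂ : P p₀ * P p₂ = 0 := by
    rw [← map_mul, ← map_zero P]
    exact P_eq (c ^ 2 * (Polynomial.X + 2)) (by ring)
  have h₁₂ : P p₁ * P p₂ = 0 := by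
    rw [← map_mul, ← map_zero P]
    exact P_eq (-2 * c ^ 2 * Polynomial.X) (by ring)
  have h₂₂ : P p₂ * P p₂ = P p₂ := by
    rw [← map_mul]
    refine P_eq (c ^ 2 * (Polynomial.X - 2)) ?_
    linear_combination c * Polynomial.X * (Polynomial.X + 2) * hc
  have h0 {e : Q} (he : (u + 4) * e = 0) : P p₀ * e = 0 := by
    simpa using P_mul_eq he (q := 0) (c * (Polynomial.X + 2)) (by ring)
  have h1 {e : Q} (he : (u + 4) * e = 0) : P p₁ * e = 0 := by
    simpa using P_mul_eq he (q := 0) (-(2 * c) * Polynomial.X) (by ring)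
  have h2 {e : Q} (he : (u + 4) * e = 0) : P p₂ * e = e := by
    simpa using P_mul_eq he (q := 1) (c * (Polynomial.X - 2)) (by linear_combination hc)
  have comm (p q : Polynomial ℂ) : P p * P q = P q * P p := by rw [← map_mul, mul_comm, map_mul]
  have hxP (p : Polynomial ℂ) : Commute x (P p) := (hxu.symm.aeval_left p).symm
  rw [← hp₂] at WZ
  have YY' : Y * Y = Y := by rw [← sq]; exact sub_eq_zero.mp YY
  have ZW' : Z * W = Y := sub_eq_zero.mp ZW
  have YZ' : Y * Z = Z := by rw [ZY, sub_zero] at YZ; exact sub_eq_zero.mp YZ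
  have WY' : W * Y = W := by
    rw [YW, zero_sub, neg_add_eq_zero] at WY; exact WY
  have WZ' : W * Z = P p₂ - Y := by
    rw [ZW'] at WZ
    rw [← sub_eq_zero, ← neg_eq_zero, ← WZ]; noncomm_ring
  have ZZ' : Z * Z = 0 := by rw [← sq, ZZ]
  have WW' : W * W = 0 := by rw [← sq, WW]
  have YP (p) : Y * P p = P p * Y := (huY.aeval_left p).eq.symm
  have ZP (p) : Z * P p = P p * Z := (huZ.aeval_left p).eq.symm
  have WP (p) : W * P p = P p * W := (huW.aeval_left p).eq.symm
  obtain ⟨g, hg⟩ := exists_algHom_of_matrixUnits x (P p₀) (P p₁) ![![Y, Z], ![W, P p₂ - Y]]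
    (hxP _) (hxP _) (by simp [Fin.forall_fin_two, hxY, hxZ, hxW, (hxP p₂).sub_right hxY])
    h₀₀ h₀₁ (by rw [comm, h₀₁]) h₁₁
    (by simp [Fin.forall_fin_two, mul_sub, h0 uY, h0 uZ, h0 uW, h₀₂])
    (by simp [Fin.forall_fin_two, sub_mul, YP, ZP, WP, h0 uY, h0 uZ, h0 uW, comm p₂ p₀, h₀₂])
    (by simp [Fin.forall_fin_two, mul_sub, h1 uY, h1 uZ, h1 uW, h₁₂])
    (by simp [Fin.forall_fin_two, sub_mul, YP, ZP, WP, h1 uY, h1 uZ, h1 uW, comm p₂ p₁, h₁₂])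
    (by simp [Fin.forall_fin_two, mul_sub, sub_mul, YP, ZP, WP, h2 uY, h2 uZ, h2 uW, h₂₂,
          YY', ZW', YZ', WY', WZ', ZZ', WW', ZY, YW])
    (by
      simp only [Matrix.cons_val_zero, Matrix.cons_val_one, add_sub_cancel, ← map_add]
      rw [← map_one P]
      congr 1
      linear_combination hc)
  have hsum : P p₀ + P p₁ + P p₂ = 1 := by
    rw [← map_one P, ← map_add, ← map_add]
    congr 1
    linear_combination hc
  have hu' : 2 * P p₁ + 4 * P p₂ = -u := by
    rw [← hPX, ← map_ofNat P 2, ← map_ofNat P 4, ← map_mul, ← map_mul, ← map_add, ← map_neg]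
    congr 1
    linear_combination -Polynomial.X * hc
  refine ⟨g, ?_, ?_, ?_, ?_, ?_⟩
  · rw [hg]
    simp [← mul_add, hsum]
  · rw [hg]
    have aeval_two : Polynomial.aeval x (2 : Polynomial ℂ) = 2 := map_ofNat _ 2
    have aeval_four : Polynomial.aeval x (4 : Polynomial ℂ) = 4 := map_ofNat _ 4
    have key : x ^ 2 * P p₀ + (x ^ 2 + 2) * P p₁ + (x ^ 2 + 4) * P p₂ = x ^ 2 - u := by
      calc _ = x ^ 2 * (P p₀ + P p₁ + P p₂) + (2 * P p₁ + 4 * P p₂) := by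
            simp only [mul_add, add_mul]
            abel
        _ = x ^ 2 - u := by rw [hsum, hu', mul_one, sub_eq_add_neg]
    simpa [aeval_two, aeval_four, ← mul_add] using key
  all_goals simp [hg, Matrix.single_apply]

/-- Evaluating `p` at the diagonal copy of the variable gives the diagonal copy of `p`. -/
theorem aeval_prod_scalar (p : Polynomial ℂ) :
    Polynomial.aeval ((Polynomial.X, Polynomial.X, Matrix.scalar _ Polynomial.X) :
      Polynomial ℂ × Polynomial ℂ × Matrix (Fin 2) (Fin 2) (Polynomial ℂ)) p =
    (p, p, Matrix.scalar _ p) :=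
  DFunLike.congr_fun (Polynomial.algHom_ext (Polynomial.aeval_X _) : Polynomial.aeval _ =
    (AlgHom.id ℂ _).prod ((AlgHom.id ℂ _).prod (Matrix.scalarAlgHom (Fin 2) ℂ))) p

/-- `R/I₂ ≅ ℂ[t] × ℂ[t] × M₂(ℂ[t])` as ℂ-algebras. -/
theorem stmt_4 :
    Nonempty (I2.ringCon.Quotient ≃ₐ[ℂ]
      (Polynomial ℂ × Polynomial ℂ × Matrix (Fin 2) (Fin 2) (Polynomial ℂ))) := by
  obtain ⟨f, fx, fy, fY, fZ, fW⟩ := RAlg.exists_algHom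
    (T := Polynomial ℂ × Polynomial ℂ × Matrix (Fin 2) (Fin 2) (Polynomial ℂ))
    ⟨(Polynomial.X, Polynomial.X, Matrix.scalar _ Polynomial.X), Subalgebra.mem_center_iff.mpr
      fun b ↦ by ext <;> simp [mul_comm]⟩
    ⟨(Polynomial.X ^ 2, Polynomial.X ^ 2 + 2, Matrix.scalar _ (Polynomial.X ^ 2 + 4)),
      Subalgebra.mem_center_iff.mpr fun b ↦ by ext <;> simp [mul_comm]⟩
    (0, 0, Matrix.single 0 0 1) (0, 0, Matrix.single 0 1 1) (0, 0, Matrix.single 1 0 1)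
  have fu : f cx ^ 2 - f cy = (0, -2, -4) := by
    rw [fx, fy]
    refine Prod.ext ?_ (Prod.ext ?_ ?_)
    · simp
    · simp
    · change Matrix.scalar (Fin 2) Polynomial.X ^ 2 -
        Matrix.scalar (Fin 2) (Polynomial.X ^ 2 + 4) = _
      rw [← map_pow (Matrix.scalar _), ← map_sub, sub_add_cancel_left, map_neg, map_ofNat]
  have hker : I2 ≤ TwoSidedIdeal.ker f := by
    rw [I2, TwoSidedIdeal.span_le]
    rintro r (rfl | rfl | rfl | rfl | rfl | rfl | rfl | rfl | rfl | rfl | rfl | rfl | rfl)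
    all_goals
      simp only [SetLike.mem_coe, TwoSidedIdeal.mem_ker, map_sub, map_add, map_mul, map_smul,
        map_pow, map_ofNat, fu, fY, fZ, fW]
      refine Prod.ext ?_ (Prod.ext ?_ ?_)
      all_goals simp [sq]
    have h8 : (4 * (-4 + 2) : Matrix (Fin 2) (Fin 2) (Polynomial ℂ)) = (8 : ℂ) • (-1) := by
      rw [Algebra.smul_def, map_ofNat]
      norm_num
    rw [h8, inv_smul_smul₀ (by norm_num), Matrix.ext_iff.symm]
    simp [Fin.forall_fin_two, two_mul]
  obtain ⟨π, hπ, hπ_surj, F, hF⟩ : ∃ π : RAlg →ₐ[ℂ] I2.ringCon.Quotient,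
      (∀ r ∈ I2, π r = 0) ∧ Function.Surjective π ∧
      ∃ F : I2.ringCon.Quotient →ₐ[ℂ] _, ∀ r, F (π r) = f r :=
    ⟨I2.ringCon.mkₐ ℂ, fun r hr ↦ (RingCon.eq _).mpr (TwoSidedIdeal.mem_iff _ _ |>.mp hr),
      Quotient.mk''_surjective, I2.ringCon.liftₐ f fun a b h ↦
        TwoSidedIdeal.ringCon_le_iff.mp hker h, fun r ↦ rfl⟩
  have hrel := fun r hr ↦ hπ r (TwoSidedIdeal.subset_span hr)
  simp only [Set.mem_insert_iff, Set.mem_singleton_iff, forall_eq_or_imp, forall_eq, map_sub,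
    map_add, map_mul, map_smul, map_pow, map_ofNat] at hrel
  have hxπ (r : RAlg) : Commute (π cx) (π r) :=
    Commute.map (Algebra.commute_algebraMap_left _ r) π
  have huπ (r : RAlg) : Commute (π cx ^ 2 - π cy) (π r) :=
    ((hxπ r).pow_left 2).sub_left (Commute.map (Algebra.commute_algebraMap_left _ r) π)
  obtain ⟨hu, huY, huZ, huW, hYY, hZZ, hWW, hZY, hYW, hZW, hYZ, hWY, hWZ⟩ := hrel
  obtain ⟨g, gx, gy, hgY, hgZ, hgW⟩ := exists_algHom_of_relations (π cx) (π cx ^ 2 - π cy)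
    (π gY) (π gZ) (π gW) (((hxπ cx).pow_right 2).sub_right (hxπ cy)) (hxπ _) (hxπ _) (hxπ _)
    (huπ _) (huπ _) (huπ _)
    hu huY huZ huW hYY hZZ hWW hZY hYW hZW hYZ hWY hWZ
  have hgf : g.comp f = π := RAlg.algHom_ext (by simpa [fx] using gx) (by simpa [fy] using gy)
    (by simpa [fY] using hgY) (by simpa [fZ] using hgZ) (by simpa [fW] using hgW)
  have hf_surj : Function.Surjective f := by
    intro t
    let P : Polynomial ℂ →ₐ[ℂ] RAlg := Polynomial.aeval cx
    have hP (p : Polynomial ℂ) : f (P p) = (p, p, Matrix.scalar _ p) := by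
      rw [← Polynomial.aeval_algHom_apply, fx, aeval_prod_scalar]
    let u := cx ^ 2 - cy
    have fu' : f u = (0, -2, -4) := by rw [map_sub, map_pow, fu]
    refine ⟨P t.1 * ((8⁻¹ : ℂ) • ((u + 2) * (u + 4))) +
      P t.2.1 * ((-4⁻¹ : ℂ) • (u * (u + 4))) + (P (t.2.2 0 0) * gY + P (t.2.2 0 1) * gZ +
        P (t.2.2 1 0) * gW + P (t.2.2 1 1) * (gW * gZ)), ?_⟩
    simp only [map_add, map_mul, map_smul, map_ofNat, hP, fu', fY, fZ, fW]
    refine Prod.ext ?_ (Prod.ext ?_ ?_)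
    · have h8 : t.1 * (2 * 4) = (8 : ℂ) • t.1 := by
        rw [Algebra.smul_def, map_ofNat]
        ring
      simp [h8]
    · have h4 : t.2.1 * (2 * (-2 + 4)) = (4 : ℂ) • t.2.1 := by
        rw [Algebra.smul_def, map_ofNat]
        ring
      simp [h4]
    · rw [← Matrix.ext_iff]
      simp [Fin.forall_fin_two]
  refine ⟨AlgEquiv.ofBijective F ⟨Function.LeftInverse.injective (g := g) fun q ↦ ?_, fun t ↦ ?_⟩⟩
  · obtain ⟨r, rfl⟩ := hπ_surj q
    rw [hF]
    exact DFunLike.congr_fun hgf r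
  · obtain ⟨r, rfl⟩ := hf_surj t
    exact ⟨π r, hF r⟩
end
end

section
/- Let R = ℂ[x,y]⟨Y,Z,W⟩ and let I₂ ⊆ R be the two-sided ideal generated by the thirteen elements (x²−y)(x²−y+2)(x²−y+4), (x²−y+4)Y, (x²−y+4)Z, (x²−y+4)W, Y²−Y, Z², W², ZY, YW, ZW−Y, YZ−ZY−Z, YW−WY+W, and ZW−WZ+(1/8)(x²−y)(x²−y+2)−2Y. Then R/I₂ is isomorphic as a ℂ-algebra to the product of ℂ[x,y]/((x²−y)(x²−y+2)) and M₂(ℂ[t]). -/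
noncomputable section
open MvPolynomial

/-- If `Y, Z, W, W * Z` multiply like the matrix units of `2 × 2` matrices, are annihilated by the
idempotent scalar `e`, and `1 = e + Y + W * Z`, then together with `e` they span the algebra that
`Y, Z, W` generate. -/
theorem exists_eq_idempotent_add_matrixUnits {K B : Type*} [CommRing K] [Ring B] [Algebra K B]
    {e : K} {Y Z W : B} (hee : (e * e) • (1 : B) = e • (1 : B))
    (heY : e • Y = 0) (heZ : e • Z = 0) (heW : e • W = 0) (hone : 1 = e • (1 : B) + Y + W * Z)
    (hYY : Y * Y = Y) (hYZ : Y * Z = Z) (hYW : Y * W = 0) (hZY : Z * Y = 0) (hZZ : Z * Z = 0)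
    (hZW : Z * W = Y) (hWY : W * Y = W) (hWW : W * W = 0) {q : B}
    (hq : q ∈ Algebra.adjoin K {Y, Z, W}) :
    ∃ p a b c d : K, q = p • e • (1 : B) + (a • Y + b • Z + c • W + d • (W * Z)) := by
  induction hq using Algebra.adjoin_induction with
  | mem x hx =>
    rcases hx with rfl | rfl | rfl
    · exact ⟨0, 1, 0, 0, 0, by simp⟩
    · exact ⟨0, 0, 1, 0, 0, by simp⟩
    · exact ⟨0, 0, 0, 1, 0, by simp⟩
  | algebraMap r =>
    refine ⟨r, r, 0, 0, r, ?_⟩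
    rw [Algebra.algebraMap_eq_smul_one, hone]
    conv_lhs => rw [smul_add, smul_add]
    conv_rhs => rw [← hone]
    simp [add_assoc]
  | add x y _ _ hx hy =>
    obtain ⟨p, a, b, c, d, rfl⟩ := hx
    obtain ⟨p', a', b', c', d', rfl⟩ := hy
    exact ⟨p + p', a + a', b + b', c + c', d + d', by module⟩
  | mul x y _ _ hx hy =>
    obtain ⟨p, a, b, c, d, rfl⟩ := hx
    obtain ⟨p', a', b', c', d', rfl⟩ := hy
    refine ⟨p * p', a * a' + b * c', a * b' + b * d', c * a' + d * c', c * b' + d * d', ?_⟩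
    have hZWr : ∀ r : B, Z * (W * r) = Y * r := fun r => by rw [← mul_assoc, hZW]
    have hYWr : ∀ r : B, Y * (W * r) = 0 := fun r => by rw [← mul_assoc, hYW, zero_mul]
    have hWWr : ∀ r : B, W * (W * r) = 0 := fun r => by rw [← mul_assoc, hWW, zero_mul]
    have hEE : (e • (1 : B)) * (e • (1 : B)) = e • (1 : B) := by simp [smul_smul, hee]
    have hEl : ∀ r : B, e • r = 0 → (e • (1 : B)) * r = 0 := fun r hr => by simp [hr]
    have hEr : ∀ r : B, e • r = 0 → r * (e • (1 : B)) = 0 := fun r hr => by simp [hr]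
    have hEY := hEl Y heY
    have hEZ := hEl Z heZ
    have hEW := hEl W heW
    have hYE := hEr Y heY
    have hZE := hEr Z heZ
    have hWE := hEr W heW
    have hEWZ : (e • (1 : B)) * (W * Z) = 0 := by rw [← mul_assoc, hEW, zero_mul]
    generalize e • (1 : B) = E at *
    simp only [mul_add, add_mul, smul_mul_assoc, mul_smul_comm, mul_assoc,
      hYY, hYZ, hYW, hZY, hZZ, hZW, hWY, hWW, hZWr, hYWr, hWWr, mul_zero, smul_zero,
      hEE, hEY, hEZ, hEW, hYE, hZE, hWE, hEWZ]
    module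

/-- The parabola `x² - y + 4 = 0` is parametrized by `t ↦ (t, t² + 4)`. -/
def parabolaMap : MvPolynomial (Fin 2) ℂ →ₐ[ℂ] Polynomial ℂ :=
  aeval ![Polynomial.X, Polynomial.X ^ 2 + 4]

theorem sub_aeval_parabolaMap_mem (p : MvPolynomial (Fin 2) ℂ) :
    p - Polynomial.aeval (X 0) (parabolaMap p) ∈
      Ideal.span {(X 0 : MvPolynomial (Fin 2) ℂ) ^ 2 - X 1 + 4} := by
  rw [← Ideal.Quotient.eq]
  have h : (Ideal.Quotient.mkₐ ℂ (Ideal.span {(X 0 : MvPolynomial (Fin 2) ℂ) ^ 2 - X 1 + 4})) =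
      (Ideal.Quotient.mkₐ ℂ _).comp ((Polynomial.aeval (X 0)).comp parabolaMap) := by
    ext i
    fin_cases i
    · simp [parabolaMap]
    · simp only [parabolaMap, AlgHom.comp_apply, Ideal.Quotient.mkₐ_eq_mk, aeval_X]
      rw [Ideal.Quotient.eq, Ideal.mem_span_singleton]
      exact ⟨-1, by simp [map_ofNat]; ring⟩
  exact congrArg (fun g => g p) h

theorem mem_span_of_parabolaMap_eq_zero {p : MvPolynomial (Fin 2) ℂ} (h : parabolaMap p = 0) :
    p ∈ Ideal.span {(X 0 : MvPolynomial (Fin 2) ℂ) ^ 2 - X 1 + 4} := by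
  simpa [h] using sub_aeval_parabolaMap_mem p

theorem parabolaMap_aeval (p : Polynomial ℂ) :
    parabolaMap (Polynomial.aeval (X 0) p) = p := by
  have h : parabolaMap.comp (Polynomial.aeval (X 0)) = AlgHom.id ℂ _ := by
    ext
    simp [parabolaMap]
  exact congrArg (fun g => g p) h

instance : Algebra (MvPolynomial (Fin 2) ℂ) (Polynomial ℂ) := parabolaMap.toAlgebra

instance : IsScalarTower ℂ (MvPolynomial (Fin 2) ℂ) (Polynomial ℂ) :=
  IsScalarTower.of_algebraMap_eq fun r => (parabolaMap.commutes r).symm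

/-- The target of the isomorphism. -/
abbrev Target : Type :=
  (MvPolynomial (Fin 2) ℂ ⧸
    Ideal.span {((X 0 : MvPolynomial (Fin 2) ℂ) ^ 2 - X 1) *
      ((X 0 : MvPolynomial (Fin 2) ℂ) ^ 2 - X 1 + 2)}) ×
  Matrix (Fin 2) (Fin 2) (Polynomial ℂ)

/-- The generators `Y, Z, W` act as matrix units on the second factor and as zero on the first. -/
def toTarget : RAlg →ₐ[MvPolynomial (Fin 2) ℂ] Target :=
  FreeAlgebra.lift _ ![(0, !![1, 0; 0, 0]), (0, !![0, 1; 0, 0]), (0, !![0, 0; 1, 0])]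

theorem toTarget_gY : toTarget gY = (0, !![1, 0; 0, 0]) := by simp [toTarget, gY]
theorem toTarget_gZ : toTarget gZ = (0, !![0, 1; 0, 0]) := by simp [toTarget, gZ]
theorem toTarget_gW : toTarget gW = (0, !![0, 0; 1, 0]) := by simp [toTarget, gW]

theorem smul_target (p : MvPolynomial (Fin 2) ℂ) (v : Target) :
    p • v = (Ideal.Quotient.mk _ p * v.1, parabolaMap p • v.2) := by
  ext1
  · exact Algebra.smul_def p v.1
  · exact algebraMap_smul (Polynomial ℂ) p v.2 |>.symm

/-- The polynomial `x² - y`. -/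
def parabola : MvPolynomial (Fin 2) ℂ := X 0 ^ 2 - X 1

theorem cx_sq_sub_cy : cx ^ 2 - cy = algebraMap _ RAlg parabola := by
  simp [cx, cy, parabola]

theorem parabolaMap_parabola : parabolaMap parabola = -4 := by
  simp [parabolaMap, parabola]

/-- The polynomial equal to `1` on `x² - y ∈ {0, -2}` and to `0` on `x² - y = -4`. -/
def idem : MvPolynomial (Fin 2) ℂ := 1 - C 8⁻¹ * (parabola * (parabola + 2))

theorem C_inv_eight_mul : C (8⁻¹ : ℂ) * 8 = (1 : MvPolynomial (Fin 2) ℂ) := by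
  rw [show (8 : MvPolynomial (Fin 2) ℂ) = C 8 from (map_ofNat C 8).symm, ← C_mul]
  norm_num

theorem idem_eq : idem = -(C 8⁻¹) * (parabola - 2) * (parabola + 4) := by
  unfold idem
  linear_combination (-1 : MvPolynomial (Fin 2) ℂ) * C_inv_eight_mul

theorem parabolaMap_idem : parabolaMap idem = 0 := by
  rw [idem_eq, map_mul, map_add, parabolaMap_parabola, map_ofNat]
  simp

theorem toTarget_parabola :
    toTarget (algebraMap _ RAlg parabola) = (Ideal.Quotient.mk _ parabola, -4) := by
  rw [AlgHom.commutes, Algebra.algebraMap_eq_smul_one, smul_target, parabolaMap_parabola]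
  ext1
  · simp
  · ext i j
    fin_cases i <;> fin_cases j <;> simp [Matrix.ofNat_apply]

theorem mk_parabola_mul :
    (Ideal.Quotient.mk (Ideal.span {((X 0 : MvPolynomial (Fin 2) ℂ) ^ 2 - X 1) *
      ((X 0 : MvPolynomial (Fin 2) ℂ) ^ 2 - X 1 + 2)}) parabola) *
      (Ideal.Quotient.mk _ parabola + 2) = 0 := by
  rw [← map_ofNat (Ideal.Quotient.mk _) 2, ← map_add, ← map_mul, Ideal.Quotient.eq_zero_iff_mem]
  exact Ideal.mem_span_singleton_self _

theorem I2_le_ker : I2 ≤ TwoSidedIdeal.ker toTarget := by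
  have h8 : (8⁻¹ : ℂ) • ((-4 : Matrix (Fin 2) (Fin 2) (Polynomial ℂ)) * (-4 + 2)) = 1 := by
    rw [inv_smul_eq_iff₀ (by norm_num), ofNat_smul_eq_nsmul]
    norm_num
  refine TwoSidedIdeal.span_le.2 ?_
  rintro _ (rfl | rfl | rfl | rfl | rfl | rfl | rfl | rfl | rfl | rfl | rfl | rfl | rfl) <;>
    simp only [SetLike.mem_coe, TwoSidedIdeal.mem_ker, cx_sq_sub_cy, map_add, map_sub, map_mul,
      map_pow, map_ofNat, AlgHom.map_smul_of_tower, toTarget_gY, toTarget_gZ, toTarget_gW,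
      toTarget_parabola] <;>
    refine Prod.ext ?_ ?_ <;>
    first
    | simp [mk_parabola_mul]
      done
    | ext1 i j
      fin_cases i <;> fin_cases j <;> simp [pow_two, Matrix.mul_apply, Matrix.ofNat_apply]
      done
    | simp only [Prod.snd_sub, Prod.snd_add, Prod.snd_mul, Prod.smul_snd, Prod.snd_ofNat, h8,
        two_mul]
      ext1 i j
      fin_cases i <;> fin_cases j <;> simp

/-- The quotient map `R → R/I₂`. -/
def toQuot : RAlg →ₐ[MvPolynomial (Fin 2) ℂ] I2.ringCon.Quotient :=
  I2.ringCon.mkₐ _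

theorem toQuot_eq_zero {a : RAlg} (ha : a ∈ I2) : toQuot a = 0 := by
  rw [← TwoSidedIdeal.ker_ringCon_mk' I2, TwoSidedIdeal.mem_ker] at ha
  exact ha

/-- The relations of `R/I₂`, with central elements written as scalars. -/
theorem toQuot_relations :
    (parabola * (parabola + 2) * (parabola + 4)) • (1 : I2.ringCon.Quotient) = 0 ∧
    (parabola + 4) • toQuot gY = 0 ∧ (parabola + 4) • toQuot gZ = 0 ∧
    (parabola + 4) • toQuot gW = 0 ∧
    toQuot gY * toQuot gY = toQuot gY ∧ toQuot gZ * toQuot gZ = 0 ∧ toQuot gW * toQuot gW = 0 ∧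
    toQuot gZ * toQuot gY = 0 ∧ toQuot gY * toQuot gW = 0 ∧ toQuot gZ * toQuot gW = toQuot gY ∧
    toQuot gY * toQuot gZ = toQuot gZ ∧ toQuot gW * toQuot gY = toQuot gW ∧
    1 = idem • (1 : I2.ringCon.Quotient) + toQuot gY + toQuot gW * toQuot gZ := by
  have h : ∀ a ∈ _, toQuot a = 0 := fun a ha => toQuot_eq_zero (TwoSidedIdeal.subset_span ha)
  simp only [Set.mem_insert_iff, Set.mem_singleton_iff, forall_eq_or_imp, forall_eq, cx_sq_sub_cy,
    map_add, map_sub, map_mul, map_pow, map_ofNat, AlgHom.map_smul_of_tower, AlgHom.commutes] at h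
  obtain ⟨h1, h2, h3, h4, h5, h6, h7, h8, h9, h10, h11, h12, h13⟩ := h
  rw [h8, sub_zero, sub_eq_zero] at h11
  rw [h9, zero_sub, neg_add_eq_zero] at h12
  rw [sub_eq_zero] at h10
  refine ⟨?_, ?_, ?_, ?_, ?_, ?_, ?_, h8, h9, h10, h11, h12, ?_⟩
  · simpa [Algebra.smul_def, map_ofNat] using h1
  · simpa [Algebra.smul_def, map_ofNat] using h2
  · simpa [Algebra.smul_def, map_ofNat] using h3
  · simpa [Algebra.smul_def, map_ofNat] using h4
  · rwa [pow_two, sub_eq_zero] at h5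
  · rwa [pow_two] at h6
  · rwa [pow_two] at h7
  · have hf : (8⁻¹ : ℂ) • (algebraMap _ I2.ringCon.Quotient parabola *
        (algebraMap _ I2.ringCon.Quotient parabola + 2)) = 1 - idem • 1 := by
      rw [idem, sub_smul, one_smul, sub_sub_cancel, C_mul', smul_assoc,
        ← Algebra.algebraMap_eq_smul_one, map_mul, map_add, map_ofNat]
    rw [hf, h10] at h13
    rw [← sub_eq_zero, ← h13]
    noncomm_ring

theorem idem_smul_eq_zero {M : Type*} [AddCommGroup M] [Module (MvPolynomial (Fin 2) ℂ) M] {m : M}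
    (h : (parabola + 4) • m = 0) : idem • m = 0 := by
  rw [idem_eq, mul_smul, h, smul_zero]

theorem exists_normalForm (q : I2.ringCon.Quotient) :
    ∃ p a b c d : MvPolynomial (Fin 2) ℂ, q = p • idem • (1 : I2.ringCon.Quotient) +
      (a • toQuot gY + b • toQuot gZ + c • toQuot gW + d • (toQuot gW * toQuot gZ)) := by
  obtain ⟨h1, hY, hZ, hW, hYY, hZZ, hWW, hZY, hYW, hZW, hYZ, hWY, hone⟩ := toQuot_relations
  refine exists_eq_idempotent_add_matrixUnits ?_ (idem_smul_eq_zero hY) (idem_smul_eq_zero hZ)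
    (idem_smul_eq_zero hW) hone hYY hYZ hYW hZY hZZ hZW hWY hWW ?_
  · rw [← sub_eq_zero, ← sub_smul, show idem * idem - idem = (C 8⁻¹ * C 8⁻¹ * (parabola - 2)) *
      (parabola * (parabola + 2) * (parabola + 4)) by
        nth_rewrite 1 3 [idem_eq]; unfold idem; ring, mul_smul, h1, smul_zero]
  · obtain ⟨r, rfl⟩ : ∃ r, toQuot r = q := RingCon.mkₐ_surjective _ q
    have hr : r ∈ Algebra.adjoin (MvPolynomial (Fin 2) ℂ) (Set.range (FreeAlgebra.ι _)) :=
      FreeAlgebra.adjoin_range_ι (MvPolynomial (Fin 2) ℂ) (Fin 3) ▸ Algebra.mem_top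
    have := Subalgebra.mem_map.2 ⟨r, hr, (rfl : toQuot r = toQuot r)⟩
    rw [AlgHom.map_adjoin] at this
    refine Algebra.adjoin_mono ?_ this
    rintro _ ⟨_, ⟨i, rfl⟩, rfl⟩
    fin_cases i
    · exact Or.inl rfl
    · exact Or.inr (Or.inl rfl)
    · exact Or.inr (Or.inr rfl)

/-- The homomorphism `R/I₂ → ℂ[x,y]/((x²−y)(x²−y+2)) × M₂(ℂ[t])` induced by `toTarget`. -/
def quotToTarget : I2.ringCon.Quotient →ₐ[MvPolynomial (Fin 2) ℂ] Target :=
  I2.ringCon.liftₐ toTarget fun _ _ h => TwoSidedIdeal.ringCon_le_iff.1 I2_le_ker h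

theorem quotToTarget_toQuot (r : RAlg) : quotToTarget (toQuot r) = toTarget r := rfl

theorem quotToTarget_normalForm (p a b c d : MvPolynomial (Fin 2) ℂ) :
    quotToTarget (p • idem • (1 : I2.ringCon.Quotient) +
      (a • toQuot gY + b • toQuot gZ + c • toQuot gW + d • (toQuot gW * toQuot gZ))) =
    (Ideal.Quotient.mk _ p, !![parabolaMap a, parabolaMap b; parabolaMap c, parabolaMap d]) := by
  have hidem : Ideal.Quotient.mk (Ideal.span {((X 0 : MvPolynomial (Fin 2) ℂ) ^ 2 - X 1) *
      ((X 0 : MvPolynomial (Fin 2) ℂ) ^ 2 - X 1 + 2)}) idem = 1 := by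
    rw [idem, map_sub, map_mul, map_mul, map_add, map_ofNat, mk_parabola_mul]
    simp
  simp only [map_add, map_smul, map_mul, map_one, quotToTarget_toQuot, toTarget_gY, toTarget_gZ,
    toTarget_gW, smul_target, parabolaMap_idem]
  refine Prod.ext ?_ ?_
  · simp [hidem]
  · ext1 i j
    fin_cases i <;> fin_cases j <;> simp

theorem quotToTarget_surjective : Function.Surjective quotToTarget := by
  rintro ⟨v, M⟩
  obtain ⟨p, rfl⟩ := Ideal.Quotient.mk_surjective v
  refine ⟨_, (quotToTarget_normalForm p (Polynomial.aeval (X 0) (M 0 0))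
    (Polynomial.aeval (X 0) (M 0 1)) (Polynomial.aeval (X 0) (M 1 0))
    (Polynomial.aeval (X 0) (M 1 1))).trans ?_⟩
  simp only [parabolaMap_aeval, ← Matrix.eta_fin_two M]

theorem smul_eq_zero_of_parabolaMap_eq_zero {M : Type*} [AddCommGroup M]
    [Module (MvPolynomial (Fin 2) ℂ) M] {m : M} (h : (parabola + 4) • m = 0)
    {p : MvPolynomial (Fin 2) ℂ} (hp : parabolaMap p = 0) : p • m = 0 := by
  obtain ⟨r, rfl⟩ := Ideal.mem_span_singleton'.1 (mem_span_of_parabolaMap_eq_zero hp)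
  rw [mul_smul]
  exact (congrArg (r • ·) h).trans (smul_zero r)

theorem quotToTarget_injective : Function.Injective quotToTarget := by
  rw [injective_iff_map_eq_zero]
  intro q hq
  obtain ⟨p, a, b, c, d, rfl⟩ := exists_normalForm q
  obtain ⟨h1, hY, hZ, hW, -⟩ := toQuot_relations
  have hWZ : (parabola + 4) • (toQuot gW * toQuot gZ) = 0 := by
    rw [← smul_mul_assoc, hW, zero_mul]
  rw [quotToTarget_normalForm, Prod.mk_eq_zero, Ideal.Quotient.eq_zero_iff_mem] at hq
  obtain ⟨hp, hM⟩ := hq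
  have ha : parabolaMap a = 0 := congrFun₂ hM 0 0
  have hb : parabolaMap b = 0 := congrFun₂ hM 0 1
  have hc : parabolaMap c = 0 := congrFun₂ hM 1 0
  have hd : parabolaMap d = 0 := congrFun₂ hM 1 1
  obtain ⟨r, rfl⟩ := Ideal.mem_span_singleton'.1 hp
  rw [smul_eq_zero_of_parabolaMap_eq_zero hY ha, smul_eq_zero_of_parabolaMap_eq_zero hZ hb,
    smul_eq_zero_of_parabolaMap_eq_zero hW hc, smul_eq_zero_of_parabolaMap_eq_zero hWZ hd,
    ← parabola, smul_smul, idem_eq, show r * (parabola * (parabola + 2)) *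
      (-(C 8⁻¹) * (parabola - 2) * (parabola + 4)) = (r * -(C 8⁻¹) * (parabola - 2)) *
      (parabola * (parabola + 2) * (parabola + 4)) by ring, mul_smul, h1]
  simp

/-- `R/I₂ ≅ ℂ[x,y]/((x²−y)(x²−y+2)) × M₂(ℂ[t])` as ℂ-algebras. -/
theorem stmt_5 :
    Nonempty (I2.ringCon.Quotient ≃ₐ[ℂ]
      ((MvPolynomial (Fin 2) ℂ ⧸
          Ideal.span {((X 0 : MvPolynomial (Fin 2) ℂ) ^ 2 - X 1) *
            ((X 0 : MvPolynomial (Fin 2) ℂ) ^ 2 - X 1 + 2)}) ×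
        Matrix (Fin 2) (Fin 2) (Polynomial ℂ))) := by
  exact ⟨AlgEquiv.ofBijective (quotToTarget.restrictScalars ℂ)
    ⟨quotToTarget_injective, quotToTarget_surjective⟩⟩
end
end

section
/- Let R = ℂ[x,y]⟨Y,Z,W⟩ and let I₂ ⊆ R be the two-sided ideal generated by the thirteen elements (x²−y)(x²−y+2)(x²−y+4), (x²−y+4)Y, (x²−y+4)Z, (x²−y+4)W, Y²−Y, Z², W², ZY, YW, ZW−Y, YZ−ZY−Z, YW−WY+W, and ZW−WZ+(1/8)(x²−y)(x²−y+2)−2Y. Let J₁ ⊆ R be the two-sided ideal generated by x²−y, Y, Z, W; let J₂ ⊆ R be the two-sided ideal generated by x²−y+2, Y, Z, W; and let J₃ ⊆ R be the two-sided ideal generated by x²−y+4 together with the nine elements Y²−Y, Z², W², ZY, YW, ZW−Y, YZ−ZY−Z, YW−WY+W, ZW−WZ+(1/8)(x²−y)(x²−y+2)−2Y. Then R/I₂ is isomorphic as a ℂ-algebra to the product R/J₁ × R/J₂ × R/J₃. -/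
noncomputable section
open MvPolynomial

/-- The two-sided ideal `J₁` generated by `x²−y`, `Y`, `Z`, `W`. -/
def J1 : TwoSidedIdeal RAlg := TwoSidedIdeal.span {cx ^ 2 - cy, gY, gZ, gW}

/-- The two-sided ideal `J₂` generated by `x²−y+2`, `Y`, `Z`, `W`. -/
def J2 : TwoSidedIdeal RAlg := TwoSidedIdeal.span {cx ^ 2 - cy + 2, gY, gZ, gW}

/-- The two-sided ideal `J₃` generated by `x²−y+4` and the nine listed elements. -/
def J3 : TwoSidedIdeal RAlg := TwoSidedIdeal.span
  { cx ^ 2 - cy + 4,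
    gY ^ 2 - gY, gZ ^ 2, gW ^ 2, gZ * gY, gY * gW, gZ * gW - gY,
    gY * gZ - gZ * gY - gZ, gY * gW - gW * gY + gW,
    gZ * gW - gW * gZ + (8⁻¹ : ℂ) • ((cx ^ 2 - cy) * (cx ^ 2 - cy + 2)) - 2 * gY }

namespace TwoSidedIdeal

variable {k A : Type*} [CommRing k] [Ring A] [Algebra k A]

lemma smul_mem_of_mem (I : TwoSidedIdeal A) (c : k) {a : A} (ha : a ∈ I) : c • a ∈ I := by
  rw [Algebra.smul_def]
  exact I.mul_mem_left _ _ ha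

/-- To multiply a span into an ideal by a central element, it suffices to treat the generators. -/
lemma mul_mem_of_mem_span {I : TwoSidedIdeal A} {s : Set A} {e : A} (he : ∀ a, e * a = a * e)
    (hs : ∀ a ∈ s, a * e ∈ I) {a : A} (ha : a ∈ span s) : a * e ∈ I := by
  induction ha using span_induction with
  | mem a h => exact hs a h
  | zero => simp [I.zero_mem]
  | add a b _ _ ha hb => rw [add_mul]; exact I.add_mem ha hb
  | neg a _ ha => rw [neg_mul]; exact I.neg_mem ha
  | left_absorb b a _ ha => rw [mul_assoc]; exact I.mul_mem_left _ _ ha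
  | right_absorb b a _ ha =>
    rw [mul_assoc, ← he, ← mul_assoc]
    exact I.mul_mem_right _ _ ha

/-- Elements `e₁, e₂, e₃` with sum `1` that behave like orthogonal idempotents with respect to the
ideals `K₁, K₂, K₃` above `I` split the quotient by `I` into a product. -/
theorem nonempty_quotient_algEquiv_prod {I K₁ K₂ K₃ : TwoSidedIdeal A} {e₁ e₂ e₃ : A}
    (hsum : e₁ + e₂ + e₃ = 1) (hI₁ : I ≤ K₁) (hI₂ : I ≤ K₂) (hI₃ : I ≤ K₃)
    (h₁ : ∀ a ∈ K₁, a * e₁ ∈ I) (h₂ : ∀ a ∈ K₂, a * e₂ ∈ I) (h₃ : ∀ a ∈ K₃, a * e₃ ∈ I)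
    (h₁₂ : e₁ ∈ K₂) (h₁₃ : e₁ ∈ K₃) (h₂₁ : e₂ ∈ K₁) (h₂₃ : e₂ ∈ K₃)
    (h₃₁ : e₃ ∈ K₁) (h₃₂ : e₃ ∈ K₂) :
    Nonempty (I.ringCon.Quotient ≃ₐ[k]
      (K₁.ringCon.Quotient × K₂.ringCon.Quotient × K₃.ringCon.Quotient)) := by
  let f : A →+* K₁.ringCon.Quotient × K₂.ringCon.Quotient × K₃.ringCon.Quotient :=
    K₁.ringCon.mk'.prod (K₂.ringCon.mk'.prod K₃.ringCon.mk')
  have hf (a b : A) : f a = f b ↔ a - b ∈ K₁ ∧ a - b ∈ K₂ ∧ a - b ∈ K₃ := by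
    rw [← rel_iff, ← rel_iff, ← rel_iff, ← RingCon.eq, ← RingCon.eq, ← RingCon.eq]
    simp [f, Prod.ext_iff]
  have hker : I.ringCon = RingCon.ker f := by
    ext a b
    rw [RingCon.ker_apply, hf, rel_iff]
    refine ⟨fun h => ⟨hI₁ h, hI₂ h, hI₃ h⟩, fun ⟨ha₁, ha₂, ha₃⟩ => ?_⟩
    rw [← mul_one (a - b), ← hsum, mul_add, mul_add]
    exact I.add_mem (I.add_mem (h₁ _ ha₁) (h₂ _ ha₂)) (h₃ _ ha₃)
  have hsurj : Function.Surjective f := by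
    rintro ⟨⟨a⟩, ⟨b⟩, ⟨c⟩⟩
    refine ⟨a * e₁ + b * e₂ + c * e₃, Prod.ext ?_ (Prod.ext ?_ ?_)⟩
    · refine (RingCon.eq _).2 ((rel_iff _ _ _).2 ?_)
      have : a * e₁ + b * e₂ + c * e₃ - a = (b - a) * e₂ + (c - a) * e₃ := by
        calc
          _ = a * e₁ + b * e₂ + c * e₃ - a * (e₁ + e₂ + e₃) := by rw [hsum, mul_one]
          _ = _ := by noncomm_ring
      rw [this]
      exact K₁.add_mem (K₁.mul_mem_left _ _ h₂₁) (K₁.mul_mem_left _ _ h₃₁)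
    · refine (RingCon.eq _).2 ((rel_iff _ _ _).2 ?_)
      have : a * e₁ + b * e₂ + c * e₃ - b = (a - b) * e₁ + (c - b) * e₃ := by
        calc
          _ = a * e₁ + b * e₂ + c * e₃ - b * (e₁ + e₂ + e₃) := by rw [hsum, mul_one]
          _ = _ := by noncomm_ring
      rw [this]
      exact K₂.add_mem (K₂.mul_mem_left _ _ h₁₂) (K₂.mul_mem_left _ _ h₃₂)
    · refine (RingCon.eq _).2 ((rel_iff _ _ _).2 ?_)
      have : a * e₁ + b * e₂ + c * e₃ - c = (a - c) * e₁ + (b - c) * e₂ := by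
        calc
          _ = a * e₁ + b * e₂ + c * e₃ - c * (e₁ + e₂ + e₃) := by rw [hsum, mul_one]
          _ = _ := by noncomm_ring
      rw [this]
      exact K₃.add_mem (K₃.mul_mem_left _ _ h₁₃) (K₃.mul_mem_left _ _ h₂₃)
  let g := I.ringCon.lift f hker.le
  exact ⟨AlgEquiv.ofBijective (AlgHom.mk g fun c => rfl)
    (RingCon.lift_bijective_iff.2 ⟨hker, hsurj⟩)⟩

end TwoSidedIdeal

local notation "τ" => (cx ^ 2 - cy)

lemma commute_tau (a : RAlg) : Commute τ a := by
  have h : τ = algebraMap (MvPolynomial (Fin 2) ℂ) RAlg (X 0 ^ 2 - X 1) := by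
    simp [cx, cy]
  rw [h]
  exact Algebra.commutes _ _

lemma commute_tau_add_two (a : RAlg) : Commute (τ + 2) a :=
  (commute_tau a).add_left (.ofNat_left 2 a)

lemma commute_tau_add_four (a : RAlg) : Commute (τ + 4) a :=
  (commute_tau a).add_left (.ofNat_left 4 a)

lemma I2_le_of_generators_mem {K : TwoSidedIdeal RAlg} (hK : τ * (τ + 2) ∈ K)
    (hY : gY ∈ K) (hZ : gZ ∈ K) (hW : gW ∈ K) : I2 ≤ K := by
  refine TwoSidedIdeal.span_le.2 ?_
  simp only [Set.insert_subset_iff, Set.singleton_subset_iff, SetLike.mem_coe, pow_two gY,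
    pow_two gZ, pow_two gW]
  have mul {a b : RAlg} (hb : b ∈ K) : a * b ∈ K := K.mul_mem_left _ _ hb
  exact ⟨K.mul_mem_right _ _ hK, mul hY, mul hZ, mul hW, K.sub_mem (mul hY) hY, mul hZ, mul hW,
    mul hY, mul hW, K.sub_mem (mul hW) hY, K.sub_mem (K.sub_mem (mul hZ) (mul hY)) hZ,
    K.add_mem (K.sub_mem (mul hW) (mul hY)) hW,
    K.sub_mem (K.add_mem (K.sub_mem (mul hW) (mul hZ)) (K.smul_mem_of_mem _ hK)) (mul hY)⟩

lemma I2_le_J1 : I2 ≤ J1 :=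
  I2_le_of_generators_mem (J1.mul_mem_right _ _ (TwoSidedIdeal.subset_span (by simp)))
    (TwoSidedIdeal.subset_span (by simp)) (TwoSidedIdeal.subset_span (by simp))
    (TwoSidedIdeal.subset_span (by simp))

lemma I2_le_J2 : I2 ≤ J2 :=
  I2_le_of_generators_mem (J2.mul_mem_left _ _ (TwoSidedIdeal.subset_span (by simp)))
    (TwoSidedIdeal.subset_span (by simp)) (TwoSidedIdeal.subset_span (by simp))
    (TwoSidedIdeal.subset_span (by simp))

lemma I2_le_J3 : I2 ≤ J3 := by
  have ht : τ + 4 ∈ J3 := TwoSidedIdeal.subset_span (by simp)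
  refine TwoSidedIdeal.span_le.2 (Set.insert_subset (J3.mul_mem_left _ _ ht)
    (Set.insert_subset (J3.mul_mem_right _ _ ht) (Set.insert_subset (J3.mul_mem_right _ _ ht)
    (Set.insert_subset (J3.mul_mem_right _ _ ht) ?_))))
  exact (Set.subset_insert _ _).trans TwoSidedIdeal.subset_span

/-- In `R/I₂`, a central multiple of `τ + 4` that annihilates `u` annihilates `(u, Y, Z, W)`. -/
lemma mul_mem_I2_of_mem_span {u d : RAlg} (hd : ∀ a, Commute d a) (hu : u * (d * (τ + 4)) ∈ I2)
    {a : RAlg} (ha : a ∈ TwoSidedIdeal.span {u, gY, gZ, gW}) : a * (d * (τ + 4)) ∈ I2 := by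
  refine TwoSidedIdeal.mul_mem_of_mem_span
    (fun a => ((hd a).mul_left (commute_tau_add_four a)).eq) ?_ ha
  have key {g : RAlg} (hg : (τ + 4) * g ∈ I2) : g * (d * (τ + 4)) ∈ I2 := by
    rw [← ((hd g).mul_left (commute_tau_add_four g)).eq, mul_assoc]
    exact I2.mul_mem_left _ _ hg
  simp only [Set.forall_mem_insert, Set.mem_singleton_iff, forall_eq]
  exact ⟨hu, key (TwoSidedIdeal.subset_span (by simp)), key (TwoSidedIdeal.subset_span (by simp)),
    key (TwoSidedIdeal.subset_span (by simp))⟩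

lemma tau_cubic_mem_I2 : τ * (τ + 2) * (τ + 4) ∈ I2 := TwoSidedIdeal.subset_span (by simp)

lemma mul_mem_I2_of_mem_J1 {a : RAlg} (ha : a ∈ J1) :
    a * ((8⁻¹ : ℂ) • (τ + 2) * (τ + 4)) ∈ I2 := by
  refine mul_mem_I2_of_mem_span (fun b => (commute_tau_add_two b).smul_left _) ?_ ha
  rw [smul_mul_assoc, mul_smul_comm, ← mul_assoc]
  exact I2.smul_mem_of_mem _ tau_cubic_mem_I2

lemma mul_mem_I2_of_mem_J2 {a : RAlg} (ha : a ∈ J2) :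
    a * ((-4⁻¹ : ℂ) • τ * (τ + 4)) ∈ I2 := by
  refine mul_mem_I2_of_mem_span (fun b => (commute_tau b).smul_left _) ?_ ha
  rw [smul_mul_assoc, mul_smul_comm, ← mul_assoc, ← (commute_tau (τ + 2)).eq]
  exact I2.smul_mem_of_mem _ tau_cubic_mem_I2

lemma mul_mem_I2_of_mem_J3 {a : RAlg} (ha : a ∈ J3) :
    a * ((8⁻¹ : ℂ) • τ * (τ + 2)) ∈ I2 := by
  have he (b : RAlg) : Commute ((8⁻¹ : ℂ) • τ * (τ + 2)) b :=
    ((commute_tau b).smul_left _).mul_left (commute_tau_add_two b)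
  refine TwoSidedIdeal.mul_mem_of_mem_span (fun b => (he b).eq) ?_ ha
  refine Set.forall_mem_insert.2
    ⟨?_, fun b hb => I2.mul_mem_right _ _ (TwoSidedIdeal.subset_span ?_)⟩
  · rw [← (he _).eq, smul_mul_assoc, smul_mul_assoc]
    exact I2.smul_mem_of_mem _ tau_cubic_mem_I2
  · iterate 4 apply Set.mem_insert_of_mem
    exact hb

lemma lagrange_sum_eq_one : (8⁻¹ : ℂ) • (τ + 2) * (τ + 4) + (-4⁻¹ : ℂ) • τ * (τ + 4) +
    (8⁻¹ : ℂ) • τ * (τ + 2) = 1 := by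
  have h : (τ + 2) * (τ + 4) - (2 : ℂ) • (τ * (τ + 4)) + τ * (τ + 2) = (8 : ℂ) • (1 : RAlg) := by
    simp only [ofNat_smul_eq_nsmul]
    noncomm_ring
    norm_num [nsmul_eq_mul]
  have h' := congrArg ((8⁻¹ : ℂ) • ·) h
  simp only [smul_add, smul_sub, smul_smul] at h'
  norm_num at h'
  rw [← h']
  simp only [smul_mul_assoc]
  module

/-- `R/I₂ ≅ R/J₁ × R/J₂ × R/J₃` as ℂ-algebras. -/
theorem stmt_6 :
    Nonempty (I2.ringCon.Quotient ≃ₐ[ℂ]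
      (J1.ringCon.Quotient × J2.ringCon.Quotient × J3.ringCon.Quotient)) := by
  have h₁ : τ ∈ J1 := TwoSidedIdeal.subset_span (by simp)
  have h₂ : τ + 2 ∈ J2 := TwoSidedIdeal.subset_span (by simp)
  have h₃ : τ + 4 ∈ J3 := TwoSidedIdeal.subset_span (by simp)
  exact TwoSidedIdeal.nonempty_quotient_algEquiv_prod lagrange_sum_eq_one
    I2_le_J1 I2_le_J2 I2_le_J3
    (fun _ => mul_mem_I2_of_mem_J1) (fun _ => mul_mem_I2_of_mem_J2) (fun _ => mul_mem_I2_of_mem_J3)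
    (J2.mul_mem_right _ _ (J2.smul_mem_of_mem _ h₂)) (J3.mul_mem_left _ _ h₃)
    (J1.mul_mem_right _ _ (J1.smul_mem_of_mem _ h₁)) (J3.mul_mem_left _ _ h₃)
    (J1.mul_mem_right _ _ (J1.smul_mem_of_mem _ h₁)) (J2.mul_mem_left _ _ h₂)
end
end

section
/- Let R = ℂ[x,y]⟨Y,Z,W⟩ and let J₃ ⊆ R be the two-sided ideal generated by x²−y+4 together with the nine elements Y²−Y, Z², W², ZY, YW, ZW−Y, YZ−ZY−Z, YW−WY+W, and ZW−WZ+(1/8)(x²−y)(x²−y+2)−2Y. Then R/J₃ is isomorphic as a ℂ-algebra to M₂(ℂ[t]). -/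
noncomputable section
open MvPolynomial

/-- A central homomorphism from `S` and a complete system of matrix units in `A` induce an algebra
homomorphism from the matrix algebra over `S`. -/
def algHomOfMatrixUnits {k S A n : Type*} [CommRing k] [CommRing S] [Ring A] [Algebra k S]
    [Algebra k A] [Fintype n] [DecidableEq n] (τ : S →ₐ[k] A) (hτ : ∀ s a, Commute (τ s) a)
    (e : n → n → A) (he : ∀ i j l m, e i j * e l m = if j = l then e i m else 0)
    (he_one : ∑ i, e i i = 1) : Matrix n n S →ₐ[k] A :=
  AlgHom.ofLinearMap
    { toFun := fun M => ∑ i, ∑ j, τ (M i j) * e i j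
      map_add' := fun M N => by simp [add_mul, Finset.sum_add_distrib]
      map_smul' := fun c M => by simp [Finset.smul_sum] }
    (by simp [Matrix.one_apply, apply_ite τ, he_one])
    (fun M N => by
      have hterm : ∀ i j l m, τ (M i j) * e i j * (τ (N l m) * e l m) =
          if j = l then τ (M i j * N l m) * e i m else 0 := fun i j l m => by
        rw [mul_assoc, ← mul_assoc (e i j), ← (hτ (N l m) (e i j)).eq, mul_assoc, he, ← mul_assoc,
          ← map_mul, mul_ite, mul_zero]
      simp only [LinearMap.coe_mk, AddHom.coe_mk, Matrix.mul_apply, map_sum, Finset.sum_mul]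
      simp only [Finset.mul_sum, hterm]
      refine Finset.sum_congr rfl fun i _ => ?_
      rw [Finset.sum_comm]
      simp)

theorem algHomOfMatrixUnits_apply {k S A n : Type*} [CommRing k] [CommRing S] [Ring A]
    [Algebra k S] [Algebra k A] [Fintype n] [DecidableEq n] (τ : S →ₐ[k] A)
    (hτ : ∀ s a, Commute (τ s) a) (e : n → n → A)
    (he : ∀ i j l m, e i j * e l m = if j = l then e i m else 0) (he_one : ∑ i, e i i = 1)
    (M : Matrix n n S) :
    algHomOfMatrixUnits τ hτ e he he_one M = ∑ i, ∑ j, τ (M i j) * e i j :=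
  rfl

/-- A central homomorphism from `S` and a family of elements of `A` induce a homomorphism from the
free algebra over `S`. -/
def freeAlgebraLift {k S A σ : Type*} [CommRing k] [CommRing S] [Ring A] [Algebra k S]
    [Algebra k A] (f : S →ₐ[k] A) (hf : ∀ s a, Commute (f s) a) (g : σ → A) :
    FreeAlgebra S σ →ₐ[k] A :=
  letI : Algebra S A := f.toRingHom.toAlgebra' hf
  haveI : IsScalarTower k S A := IsScalarTower.of_algebraMap_eq fun c => (f.commutes c).symm
  (FreeAlgebra.lift S g).restrictScalars k

section freeAlgebraLift

variable {k S A σ : Type*} [CommRing k] [CommRing S] [Ring A] [Algebra k S] [Algebra k A]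
  (f : S →ₐ[k] A) (hf : ∀ s a, Commute (f s) a) (g : σ → A)

theorem freeAlgebraLift_algebraMap (s : S) :
    freeAlgebraLift f hf g (algebraMap S _ s) = f s :=
  letI : Algebra S A := f.toRingHom.toAlgebra' hf
  (FreeAlgebra.lift S g).commutes s

theorem freeAlgebraLift_ι (i : σ) : freeAlgebraLift f hf g (FreeAlgebra.ι S i) = g i :=
  letI : Algebra S A := f.toRingHom.toAlgebra' hf
  FreeAlgebra.lift_ι_apply g i

end freeAlgebraLift

/-- The homomorphism `ℂ[x,y] → M₂(ℂ[t])` with `x ↦ t` and `y ↦ t² + 4`. -/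
def centerToMatrix : MvPolynomial (Fin 2) ℂ →ₐ[ℂ] Matrix (Fin 2) (Fin 2) (Polynomial ℂ) :=
  (IsScalarTower.toAlgHom ℂ (Polynomial ℂ) (Matrix (Fin 2) (Fin 2) (Polynomial ℂ))).comp
    (aeval ![Polynomial.X, Polynomial.X ^ 2 + 4])

theorem commute_centerToMatrix (p : MvPolynomial (Fin 2) ℂ)
    (M : Matrix (Fin 2) (Fin 2) (Polynomial ℂ)) : Commute (centerToMatrix p) M :=
  Algebra.commutes (aeval ![Polynomial.X, Polynomial.X ^ 2 + 4] p : Polynomial ℂ) M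

/-- The homomorphism `R → M₂(ℂ[t])` with `x ↦ t`, `y ↦ t² + 4`, sending `Y, Z, W` to the matrix
units `E₁₁, E₁₂, E₂₁`. -/
def toMatrix : RAlg →ₐ[ℂ] Matrix (Fin 2) (Fin 2) (Polynomial ℂ) :=
  freeAlgebraLift centerToMatrix commute_centerToMatrix
    ![!![1, 0; 0, 0], !![0, 1; 0, 0], !![0, 0; 1, 0]]

theorem toMatrix_algebraMap (p : MvPolynomial (Fin 2) ℂ) :
    toMatrix (algebraMap _ RAlg p) = centerToMatrix p :=
  freeAlgebraLift_algebraMap ..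

theorem toMatrix_ι (i : Fin 3) : toMatrix (FreeAlgebra.ι _ i) =
    ![!![1, 0; 0, 0], !![0, 1; 0, 0], !![0, 0; 1, 0]] i :=
  freeAlgebraLift_ι ..

theorem toMatrix_cx : toMatrix cx = algebraMap (Polynomial ℂ) _ Polynomial.X := by
  simp [cx, toMatrix_algebraMap, centerToMatrix]

theorem toMatrix_cy : toMatrix cy = algebraMap (Polynomial ℂ) _ (Polynomial.X ^ 2 + 4) := by
  simp [cy, toMatrix_algebraMap, centerToMatrix]

theorem toMatrix_gY : toMatrix gY = !![1, 0; 0, 0] := toMatrix_ι 0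

theorem toMatrix_gZ : toMatrix gZ = !![0, 1; 0, 0] := toMatrix_ι 1

theorem toMatrix_gW : toMatrix gW = !![0, 0; 1, 0] := toMatrix_ι 2

theorem toMatrix_cy_eq : toMatrix cy = toMatrix cx ^ 2 + 4 := by
  rw [toMatrix_cx, toMatrix_cy, map_add, map_pow, map_ofNat]

theorem inv_eight_smul_neg_four_mul {A : Type*} [Ring A] [Algebra ℂ A] :
    (8⁻¹ : ℂ) • ((-4 : A) * (-4 + 2)) = 1 := by
  have h8 : (-4 : A) * (-4 + 2) = algebraMap ℂ _ 8 := by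
    rw [map_ofNat]; norm_num
  rw [h8, Algebra.smul_def, ← map_mul]
  norm_num

theorem J3_le_ker_toMatrix : J3 ≤ TwoSidedIdeal.ker toMatrix := by
  refine TwoSidedIdeal.span_le.mpr ?_
  rintro r (rfl | rfl | rfl | rfl | rfl | rfl | rfl | rfl | rfl | rfl) <;>
    rw [SetLike.mem_coe, TwoSidedIdeal.mem_ker] <;>
    simp only [map_sub, map_add, map_mul, map_smul, map_pow, map_ofNat, toMatrix_cy_eq,
      sub_add_cancel_left, inv_eight_smul_neg_four_mul, toMatrix_gY, toMatrix_gZ, toMatrix_gW,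
      neg_add_cancel, two_mul] <;>
    ext i j : 1 <;> fin_cases i <;> fin_cases j <;> simp [pow_two]

/-- The quotient map `R → R/J₃`. -/
def mkJ3 : RAlg →ₐ[ℂ] J3.ringCon.Quotient := J3.ringCon.mkₐ ℂ

theorem mkJ3_surjective : Function.Surjective mkJ3 := J3.ringCon.mk'_surjective

theorem mkJ3_eq_zero {r : RAlg} (hr : r ∈ J3) : mkJ3 r = 0 := J3.ringCon.eq.mpr hr

theorem commute_mkJ3_algebraMap (p : MvPolynomial (Fin 2) ℂ) (a : J3.ringCon.Quotient) :
    Commute (mkJ3 (algebraMap _ RAlg p)) a := by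
  obtain ⟨r, rfl⟩ := mkJ3_surjective a
  exact Commute.map (Algebra.commutes p r) mkJ3

/-- The images of `Y, Z, W, 1 - Y` in `R/J₃`, arranged as matrix units. -/
def unitJ3 : Fin 2 → Fin 2 → J3.ringCon.Quotient :=
  ![![mkJ3 gY, mkJ3 gZ], ![mkJ3 gW, 1 - mkJ3 gY]]

theorem mkJ3_cy : mkJ3 cy = mkJ3 cx ^ 2 + 4 := by
  have h : mkJ3 (cx ^ 2 - cy + 4) = 0 :=
    mkJ3_eq_zero (TwoSidedIdeal.subset_span (by simp))
  simp only [map_add, map_sub, map_pow, map_ofNat] at h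
  rw [← sub_eq_zero, ← neg_eq_zero, ← h]
  abel

theorem unitJ3_mul (i j l m : Fin 2) :
    unitJ3 i j * unitJ3 l m = if j = l then unitJ3 i m else 0 := by
  have hYY : mkJ3 (gY ^ 2 - gY) = 0 := mkJ3_eq_zero (TwoSidedIdeal.subset_span (by simp))
  have hZZ : mkJ3 (gZ ^ 2) = 0 := mkJ3_eq_zero (TwoSidedIdeal.subset_span (by simp))
  have hWW : mkJ3 (gW ^ 2) = 0 := mkJ3_eq_zero (TwoSidedIdeal.subset_span (by simp))
  have hZY : mkJ3 (gZ * gY) = 0 := mkJ3_eq_zero (TwoSidedIdeal.subset_span (by simp))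
  have hYW : mkJ3 (gY * gW) = 0 := mkJ3_eq_zero (TwoSidedIdeal.subset_span (by simp))
  have hZW : mkJ3 (gZ * gW - gY) = 0 := mkJ3_eq_zero (TwoSidedIdeal.subset_span (by simp))
  have hYZ : mkJ3 (gY * gZ - gZ * gY - gZ) = 0 :=
    mkJ3_eq_zero (TwoSidedIdeal.subset_span (by simp))
  have hWY : mkJ3 (gY * gW - gW * gY + gW) = 0 :=
    mkJ3_eq_zero (TwoSidedIdeal.subset_span (by simp))
  have hWZ : mkJ3 (gZ * gW - gW * gZ + (8⁻¹ : ℂ) • ((cx ^ 2 - cy) * (cx ^ 2 - cy + 2)) - 2 * gY)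
      = 0 := mkJ3_eq_zero (TwoSidedIdeal.subset_span (by simp))
  simp only [map_sub, map_add, map_mul, map_smul, map_ofNat, mkJ3_cy,
    sub_add_cancel_left, pow_two] at hYY hZZ hWW hZY hYW hZW hYZ hWY hWZ
  rw [inv_eight_smul_neg_four_mul] at hWZ
  rw [hZY, sub_zero, sub_eq_zero] at hYZ
  rw [hYW, zero_sub, neg_add_eq_zero] at hWY
  rw [sub_eq_zero] at hYY hZW
  replace hWZ : mkJ3 gW * mkJ3 gZ = 1 - mkJ3 gY := by
    rw [hZW] at hWZ
    rw [← sub_eq_zero, ← neg_eq_zero, ← hWZ, two_mul]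
    abel
  fin_cases i <;> fin_cases j <;> fin_cases l <;> fin_cases m <;>
    simp [unitJ3, mul_sub, sub_mul, *]

theorem unitJ3_sum : ∑ i, unitJ3 i i = 1 := by simp [unitJ3]

/-- The homomorphism `M₂(ℂ[t]) → R/J₃` inverse to the one induced by `toMatrix`. -/
def matrixToJ3 : Matrix (Fin 2) (Fin 2) (Polynomial ℂ) →ₐ[ℂ] J3.ringCon.Quotient :=
  algHomOfMatrixUnits (Polynomial.aeval (mkJ3 cx))
    (fun s a => by
      induction s using Polynomial.induction_on' with
      | add p q hp hq => rw [map_add]; exact hp.add_left hq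
      | monomial n c =>
        rw [Polynomial.aeval_monomial]
        exact (Algebra.commute_algebraMap_left c a).mul_left ((commute_mkJ3_algebraMap _ a).pow_left n))
    unitJ3 unitJ3_mul unitJ3_sum

theorem matrixToJ3_apply (M : Matrix (Fin 2) (Fin 2) (Polynomial ℂ)) :
    matrixToJ3 M = ∑ i, ∑ j, Polynomial.aeval (mkJ3 cx) (M i j) * unitJ3 i j :=
  algHomOfMatrixUnits_apply ..

theorem matrixToJ3_toMatrix_cx : matrixToJ3 (toMatrix cx) = mkJ3 cx := by
  rw [toMatrix_cx, matrixToJ3_apply]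
  simp [Matrix.algebraMap_matrix_apply, unitJ3, ← mul_add]

theorem matrixToJ3_toMatrix (r : RAlg) : matrixToJ3 (toMatrix r) = mkJ3 r := by
  induction r using FreeAlgebra.induction with
  | grade0 p =>
    have h : (matrixToJ3.comp toMatrix).comp (IsScalarTower.toAlgHom ℂ _ RAlg) =
        mkJ3.comp (IsScalarTower.toAlgHom ℂ (MvPolynomial (Fin 2) ℂ) RAlg) := by
      refine MvPolynomial.algHom_ext fun i => ?_
      fin_cases i
      · exact matrixToJ3_toMatrix_cx
      · change matrixToJ3 (toMatrix cy) = mkJ3 cy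
        rw [toMatrix_cy_eq, map_add, map_pow, matrixToJ3_toMatrix_cx, mkJ3_cy, map_ofNat]
    exact DFunLike.congr_fun h p
  | grade1 i =>
    rw [toMatrix_ι, matrixToJ3_apply]
    fin_cases i <;> simp [unitJ3, gY, gZ, gW]
  | mul a b ha hb => simp only [map_mul, ha, hb]
  | add a b ha hb => simp only [map_add, ha, hb]

/-- The homomorphism `R/J₃ → M₂(ℂ[t])` induced by `toMatrix`. -/
def J3ToMatrix : J3.ringCon.Quotient →ₐ[ℂ] Matrix (Fin 2) (Fin 2) (Polynomial ℂ) :=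
  RingCon.liftₐ J3.ringCon toMatrix (TwoSidedIdeal.ringCon_le_iff.mp J3_le_ker_toMatrix)

theorem J3ToMatrix_mkJ3 (r : RAlg) : J3ToMatrix (mkJ3 r) = toMatrix r := rfl

theorem J3ToMatrix_matrixToJ3 (M : Matrix (Fin 2) (Fin 2) (Polynomial ℂ)) :
    J3ToMatrix (matrixToJ3 M) = M := by
  have haeval (p : Polynomial ℂ) : J3ToMatrix (Polynomial.aeval (mkJ3 cx) p) =
      algebraMap (Polynomial ℂ) _ p := by
    rw [← Polynomial.aeval_algHom_apply, J3ToMatrix_mkJ3, toMatrix_cx,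
      Polynomial.aeval_algebraMap_apply, Polynomial.aeval_X_left_apply]
  rw [matrixToJ3_apply]
  simp only [map_sum, map_mul, haeval, ← Algebra.smul_def]
  ext i j : 1
  fin_cases i <;> fin_cases j <;>
    simp [unitJ3, J3ToMatrix_mkJ3, toMatrix_gY, toMatrix_gZ, toMatrix_gW]

/-- `R/J₃ ≅ M₂(ℂ[t])` as ℂ-algebras. -/
theorem stmt_8 :
    Nonempty (J3.ringCon.Quotient ≃ₐ[ℂ] Matrix (Fin 2) (Fin 2) (Polynomial ℂ)) :=
  ⟨AlgEquiv.ofAlgHom J3ToMatrix matrixToJ3 (AlgHom.ext J3ToMatrix_matrixToJ3)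
    (AlgHom.ext fun q => by
      obtain ⟨r, rfl⟩ := mkJ3_surjective q
      exact matrixToJ3_toMatrix r)⟩
end
end

section
/- The quotient of ℂ[x]⟨Y,Z,W⟩ by the two-sided ideal generated by the nine elements Y²−Y, Z², W², ZY, YW, ZW−Y, YZ−Z, WY−W, and WZ−1+Y is isomorphic as a ℂ-algebra to M₂(ℂ[x]). -/
noncomputable section

/-- `ℂ[x]⟨Y,Z,W⟩`: the ℂ-algebra generated by a central element `x` and three
noncommuting elements `Y, Z, W`, realized as the free associative algebra over
the polynomial ring `ℂ[x]` on three generators. -/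
abbrev AAlg : Type := FreeAlgebra (Polynomial ℂ) (Fin 3)

def aY : AAlg := FreeAlgebra.ι (Polynomial ℂ) (0 : Fin 3)
def aZ : AAlg := FreeAlgebra.ι (Polynomial ℂ) (1 : Fin 3)
def aW : AAlg := FreeAlgebra.ι (Polynomial ℂ) (2 : Fin 3)

/-- Elements `y, z, w` of an `R`-algebra multiplying like the matrix units `E₀₀, E₀₁, E₁₀`, with
`w * z = 1 - y`, determine an algebra homomorphism out of the `2 × 2` matrices over `R`. -/
def matrixTwoLift {R B : Type*} [CommRing R] [Ring B] [Algebra R B] (y z w : B)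
    (hyy : y * y = y) (hzz : z * z = 0) (hww : w * w = 0) (hzy : z * y = 0) (hyw : y * w = 0)
    (hzw : z * w = y) (hyz : y * z = z) (hwy : w * y = w) (hwz : w * z = 1 - y) :
    Matrix (Fin 2) (Fin 2) R →ₐ[R] B :=
  AlgHom.ofLinearMap
    { toFun := fun M => M 0 0 • y + M 0 1 • z + M 1 0 • w + M 1 1 • (1 - y)
      map_add' := fun M N => by simp only [Matrix.add_apply, add_smul]; abel
      map_smul' := fun r M => by
        simp only [Matrix.smul_apply, smul_eq_mul, mul_smul, smul_add, RingHom.id_apply] }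
    (by simp)
    (fun M N => by
      simp only [LinearMap.coe_mk, AddHom.coe_mk, Matrix.mul_apply, Fin.sum_univ_two, mul_add,
        add_mul, smul_mul_smul_comm, mul_sub, sub_mul, mul_one, one_mul, hyy, hzz, hww, hzy, hyw,
        hzw, hyz, hwy, hwz, smul_zero, sub_self, sub_zero]
      module)

@[simp]
theorem matrixTwoLift_apply {R B : Type*} [CommRing R] [Ring B] [Algebra R B] (y z w : B)
    (hyy : y * y = y) (hzz : z * z = 0) (hww : w * w = 0) (hzy : z * y = 0) (hyw : y * w = 0)
    (hzw : z * w = y) (hyz : y * z = z) (hwy : w * y = w) (hwz : w * z = 1 - y)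
    (M : Matrix (Fin 2) (Fin 2) R) :
    matrixTwoLift y z w hyy hzz hww hzy hyw hzw hyz hwy hwz M =
      M 0 0 • y + M 0 1 • z + M 1 0 • w + M 1 1 • (1 - y) :=
  rfl

/-- The evaluation of `ℂ[x]⟨Y,Z,W⟩` at the matrix units `E₀₀, E₀₁, E₁₀`. -/
def evalMatrixUnits : AAlg →ₐ[Polynomial ℂ] Matrix (Fin 2) (Fin 2) (Polynomial ℂ) :=
  FreeAlgebra.lift (Polynomial ℂ) ![!![1, 0; 0, 0], !![0, 1; 0, 0], !![0, 0; 1, 0]]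

@[simp]
theorem evalMatrixUnits_aY : evalMatrixUnits aY = !![1, 0; 0, 0] := by
  simp [evalMatrixUnits, aY]

@[simp]
theorem evalMatrixUnits_aZ : evalMatrixUnits aZ = !![0, 1; 0, 0] := by
  simp [evalMatrixUnits, aZ]

@[simp]
theorem evalMatrixUnits_aW : evalMatrixUnits aW = !![0, 0; 1, 0] := by
  simp [evalMatrixUnits, aW]

/-- The nine relators of the presentation. -/
abbrev relators : Set AAlg :=
  { aY ^ 2 - aY, aZ ^ 2, aW ^ 2, aZ * aY, aY * aW, aZ * aW - aY,
    aY * aZ - aZ, aW * aY - aW, aW * aZ - 1 + aY }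

theorem ringCon_span_relators_le_ker :
    (TwoSidedIdeal.span relators).ringCon ≤ RingCon.ker evalMatrixUnits.toRingHom := by
  have h : TwoSidedIdeal.span relators ≤ TwoSidedIdeal.ker evalMatrixUnits.toRingHom := by
    rw [TwoSidedIdeal.span_le]
    rintro a (rfl | rfl | rfl | rfl | rfl | rfl | rfl | rfl | rfl) <;>
      · simp only [SetLike.mem_coe, TwoSidedIdeal.mem_ker, AlgHom.toRingHom_eq_coe,
          RingHom.coe_coe, map_add, map_sub, map_mul, map_one, pow_two, evalMatrixUnits_aY,
          evalMatrixUnits_aZ, evalMatrixUnits_aW]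
        ext i j
        fin_cases i <;> fin_cases j <;> simp
  intro a b hab
  have hker := h ((TwoSidedIdeal.rel_iff _ a b).1 hab)
  rw [TwoSidedIdeal.mem_ker, map_sub, sub_eq_zero] at hker
  exact hker

/-- The quotient map onto the presented algebra. -/
abbrev toPresented : AAlg →ₐ[Polynomial ℂ] (TwoSidedIdeal.span relators).ringCon.Quotient :=
  RingCon.mkₐ (Polynomial ℂ) _

theorem toPresented_eq_zero {a : AAlg} (ha : a ∈ relators) : toPresented a = 0 :=
  (RingCon.eq _).2 ((TwoSidedIdeal.mem_iff _ a).1 (TwoSidedIdeal.subset_span ha))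

/-- The inverse of the map induced by `evalMatrixUnits` on the presented algebra. -/
def matrixToPresented : Matrix (Fin 2) (Fin 2) (Polynomial ℂ) →ₐ[Polynomial ℂ]
    (TwoSidedIdeal.span relators).ringCon.Quotient :=
  matrixTwoLift (toPresented aY) (toPresented aZ) (toPresented aW)
    (by rw [← map_mul, ← sub_eq_zero, ← map_sub, ← pow_two]; exact toPresented_eq_zero (by simp))
    (by rw [← map_mul, ← pow_two]; exact toPresented_eq_zero (by simp))
    (by rw [← map_mul, ← pow_two]; exact toPresented_eq_zero (by simp))
    (by rw [← map_mul]; exact toPresented_eq_zero (by simp))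
    (by rw [← map_mul]; exact toPresented_eq_zero (by simp))
    (by rw [← map_mul, ← sub_eq_zero, ← map_sub]; exact toPresented_eq_zero (by simp))
    (by rw [← map_mul, ← sub_eq_zero, ← map_sub]; exact toPresented_eq_zero (by simp))
    (by rw [← map_mul, ← sub_eq_zero, ← map_sub]; exact toPresented_eq_zero (by simp))
    (by
      rw [← map_mul, ← sub_eq_zero, ← map_one toPresented, ← map_sub, ← map_sub, ← sub_add]
      exact toPresented_eq_zero (by simp))

/-- The presented algebra is isomorphic to the `2 × 2` matrices, over `ℂ[x]`. -/
def presentedEquiv : (TwoSidedIdeal.span relators).ringCon.Quotient ≃ₐ[Polynomial ℂ]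
    Matrix (Fin 2) (Fin 2) (Polynomial ℂ) :=
  AlgEquiv.ofAlgHom (RingCon.liftₐ _ evalMatrixUnits ringCon_span_relators_le_ker)
    matrixToPresented
    (by
      ext M : 1
      have hY : RingCon.liftₐ _ evalMatrixUnits ringCon_span_relators_le_ker (toPresented aY) =
        !![1, 0; 0, 0] := evalMatrixUnits_aY
      have hZ : RingCon.liftₐ _ evalMatrixUnits ringCon_span_relators_le_ker (toPresented aZ) =
        !![0, 1; 0, 0] := evalMatrixUnits_aZ
      have hW : RingCon.liftₐ _ evalMatrixUnits ringCon_span_relators_le_ker (toPresented aW) =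
        !![0, 0; 1, 0] := evalMatrixUnits_aW
      rw [AlgHom.comp_apply, matrixToPresented, matrixTwoLift_apply]
      simp only [map_add, map_smul, map_sub, map_one, hY, hZ, hW]
      ext i j
      fin_cases i <;> fin_cases j <;> simp)
    (by
      apply RingCon.Quotient.hom_extₐ
      apply FreeAlgebra.hom_ext
      funext i
      have hY : matrixToPresented (evalMatrixUnits aY) = toPresented aY := by
        simp [matrixToPresented]
      have hZ : matrixToPresented (evalMatrixUnits aZ) = toPresented aZ := by
        simp [matrixToPresented]
      have hW : matrixToPresented (evalMatrixUnits aW) = toPresented aW := by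
        simp [matrixToPresented]
      fin_cases i
      · exact hY
      · exact hZ
      · exact hW)

/-- The quotient of `ℂ[x]⟨Y,Z,W⟩` by the two-sided ideal
generated by `Y²−Y, Z², W², ZY, YW, ZW−Y, YZ−Z, WY−W, WZ−1+Y` is isomorphic
as a ℂ-algebra to `M₂(ℂ[x])`. -/
theorem stmt_9 :
    Nonempty ((TwoSidedIdeal.span
        { aY ^ 2 - aY, aZ ^ 2, aW ^ 2, aZ * aY, aY * aW, aZ * aW - aY,
          aY * aZ - aZ, aW * aY - aW, aW * aZ - 1 + aY }).ringCon.Quotient ≃ₐ[ℂ]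
      Matrix (Fin 2) (Fin 2) (Polynomial ℂ)) := by
  exact ⟨presentedEquiv.restrictScalars ℂ⟩
end
end

section
/- Let R = ℂ[x,y]⟨Y,Z,W⟩ and let I₂ ⊆ R be the two-sided ideal generated by the thirteen elements (x²−y)(x²−y+2)(x²−y+4), (x²−y+4)Y, (x²−y+4)Z, (x²−y+4)W, Y²−Y, Z², W², ZY, YW, ZW−Y, YZ−ZY−Z, YW−WY+W, and ZW−WZ+(1/8)(x²−y)(x²−y+2)−2Y. Then none of the six elements (x²−y)(x²−y+2), x²−y+4, Y, Y−1, Z, W of R belongs to I₂. -/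
noncomputable section
open MvPolynomial

/-- A point `a` of `ℂ²` and three elements of a `ℂ`-algebra `A` determine a ring homomorphism from
`RAlg` which evaluates the central variables at `a`. -/
theorem exists_ringHom_eval {A : Type*} [Ring A] [Algebra ℂ A] (a : Fin 2 → ℂ) (f : Fin 3 → A) :
    ∃ φ : RAlg →+* A, φ cx = algebraMap ℂ A (a 0) ∧ φ cy = algebraMap ℂ A (a 1) ∧
      φ gY = f 0 ∧ φ gZ = f 1 ∧ φ gW = f 2 ∧ ∀ (c : ℂ) (r : RAlg), φ (c • r) = c • φ r := by
  let _ : Algebra (MvPolynomial (Fin 2) ℂ) A := Algebra.compHom A (eval a)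
  have h (p : MvPolynomial (Fin 2) ℂ) :
      algebraMap (MvPolynomial (Fin 2) ℂ) A p = algebraMap ℂ A (eval a p) := rfl
  refine ⟨(FreeAlgebra.lift (MvPolynomial (Fin 2) ℂ) f).toRingHom, ?_, ?_, ?_, ?_, ?_, ?_⟩
  · simp [cx, h]
  · simp [cy, h]
  · simp [gY]
  · simp [gZ]
  · simp [gW]
  · intro c r
    have hc : c • r = algebraMap (MvPolynomial (Fin 2) ℂ) RAlg (C c) * r := by
      rw [← Algebra.smul_def, ← MvPolynomial.algebraMap_eq, algebraMap_smul]
    rw [hc, map_mul, Algebra.smul_def]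
    simp [h]

/-- The quotient by `I2` acts on `ℂ²` over `x² - y = -4`, with `Y`, `Z`, `W` acting as the matrix
units `e₁₁`, `e₁₂`, `e₂₁`. -/
theorem exists_matrix_rep : ∃ φ : RAlg →+* Matrix (Fin 2) (Fin 2) ℂ,
    φ cx = 0 ∧ φ cy = 4 ∧ φ gY = !![1, 0; 0, 0] ∧ φ gZ = !![0, 1; 0, 0] ∧
      φ gW = !![0, 0; 1, 0] ∧ I2 ≤ TwoSidedIdeal.ker φ := by
  obtain ⟨φ, hx, hy, hY, hZ, hW, hs⟩ := exists_ringHom_eval ![0, 4]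
    ![(!![1, 0; 0, 0] : Matrix (Fin 2) (Fin 2) ℂ), !![0, 1; 0, 0], !![0, 0; 1, 0]]
  have hx : φ cx = 0 := by simpa using hx
  have hy : φ cy = 4 := hy.trans (map_ofNat (algebraMap ℂ _) 4)
  simp only [Matrix.cons_val] at hY hZ hW
  refine ⟨φ, hx, hy, hY, hZ, hW, TwoSidedIdeal.span_le.2 ?_⟩
  have h4 : (4 : Matrix (Fin 2) (Fin 2) ℂ) = !![4, 0; 0, 4] := by
    ext i j; fin_cases i <;> fin_cases j <;> rfl
  have h2 : (2 : Matrix (Fin 2) (Fin 2) ℂ) = !![2, 0; 0, 2] := by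
    ext i j; fin_cases i <;> fin_cases j <;> rfl
  intro r hr
  rw [SetLike.mem_coe, TwoSidedIdeal.mem_ker]
  simp only [Set.mem_insert_iff, Set.mem_singleton_iff] at hr
  rcases hr with rfl | rfl | rfl | rfl | rfl | rfl | rfl | rfl | rfl | rfl | rfl | rfl | rfl <;>
  · simp only [map_add, map_sub, map_mul, map_pow, hs, map_ofNat, hx, hy, hY, hZ, hW, h4, h2]
    ext i j
    fin_cases i <;> fin_cases j <;> norm_num [pow_two, Matrix.mul_apply]

/-- The quotient by `I2` has a character over `x² - y = 0` which kills `Y`, `Z`, `W`. -/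
theorem exists_character : ∃ φ : RAlg →+* ℂ,
    φ cx = 0 ∧ φ cy = 0 ∧ I2 ≤ TwoSidedIdeal.ker φ := by
  obtain ⟨φ, hx, hy, hY, hZ, hW, hs⟩ := exists_ringHom_eval (A := ℂ) 0 0
  simp only [Pi.zero_apply, map_zero] at hx hy hY hZ hW
  refine ⟨φ, hx, hy, TwoSidedIdeal.span_le.2 ?_⟩
  intro r hr
  rw [SetLike.mem_coe, TwoSidedIdeal.mem_ker]
  simp only [Set.mem_insert_iff, Set.mem_singleton_iff] at hr
  rcases hr with rfl | rfl | rfl | rfl | rfl | rfl | rfl | rfl | rfl | rfl | rfl | rfl | rfl <;>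
    simp [hs, hx, hy, hY, hZ, hW]

/-- None of the six elements `(x²−y)(x²−y+2)`, `x²−y+4`, `Y`,
`Y−1`, `Z`, `W` of `R` belongs to `I₂`. -/
theorem stmt_13 :
    (cx ^ 2 - cy) * (cx ^ 2 - cy + 2) ∉ I2 ∧
    cx ^ 2 - cy + 4 ∉ I2 ∧
    gY ∉ I2 ∧
    gY - 1 ∉ I2 ∧
    gZ ∉ I2 ∧
    gW ∉ I2 := by
  obtain ⟨φ, hx, hy, hY, hZ, hW, hφ⟩ := exists_matrix_rep
  obtain ⟨χ, hχx, hχy, hχ⟩ := exists_character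
  have entry_eq_zero {r : RAlg} (hr : r ∈ I2) (i j : Fin 2) : φ r i j = 0 := by
    rw [(TwoSidedIdeal.mem_ker φ).1 (hφ hr), Matrix.zero_apply]
  refine ⟨fun h => ?_, fun h => ?_, fun h => ?_, fun h => ?_, fun h => ?_, fun h => ?_⟩
  · have h8 : φ ((cx ^ 2 - cy) * (cx ^ 2 - cy + 2)) = 8 := by
      simp only [map_add, map_sub, map_mul, map_pow, map_ofNat, hx, hy]
      norm_num
    have := entry_eq_zero h 0 0
    rw [h8] at this
    exact absurd this (by simp [Matrix.ofNat_apply])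
  · have := (TwoSidedIdeal.mem_ker χ).1 (hχ h)
    rw [map_add, map_sub, map_pow, hχx, hχy, map_ofNat χ 4] at this
    norm_num at this
  · simpa [hY] using entry_eq_zero h 0 0
  · simpa [hY] using entry_eq_zero h 1 1
  · simpa [hZ] using entry_eq_zero h 0 1
  · simpa [hW] using entry_eq_zero h 1 0
end
end

section
/- Let R = ℂ[x,y]⟨Y,Z,W⟩ and let I₂ ⊆ R be the two-sided ideal generated by the thirteen elements (x²−y)(x²−y+2)(x²−y+4), (x²−y+4)Y, (x²−y+4)Z, (x²−y+4)W, Y²−Y, Z², W², ZY, YW, ZW−Y, YZ−ZY−Z, YW−WY+W, and ZW−WZ+(1/8)(x²−y)(x²−y+2)−2Y. Then the quotient algebra R/I₂ is not commutative. -/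
noncomputable section
open MvPolynomial

/-- The representation of `R` on `ℂ²` with `x ↦ 0`, `y ↦ 4` that sends `Y, Z, W` to the
matrix units `e₁₁, e₁₂, e₂₁`. -/
def matrixRep : RAlg →+* Matrix (Fin 2) (Fin 2) ℂ :=
  (RingHom.mapMatrix (eval ![0, 4])).comp
    (FreeAlgebra.lift (MvPolynomial (Fin 2) ℂ)
      ![!![1, 0; 0, 0], !![0, 1; 0, 0], !![0, 0; 1, 0]] :
      RAlg →ₐ[MvPolynomial (Fin 2) ℂ]
        Matrix (Fin 2) (Fin 2) (MvPolynomial (Fin 2) ℂ)).toRingHom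

lemma matrixRep_algebraMap (p : MvPolynomial (Fin 2) ℂ) :
    matrixRep (algebraMap _ RAlg p) = algebraMap ℂ _ (eval ![0, 4] p) := by
  ext i j
  by_cases h : i = j <;> simp [matrixRep, Matrix.algebraMap_matrix_apply, h]

lemma matrixRep_cx : matrixRep cx = 0 := by
  simp [cx, matrixRep_algebraMap]

lemma matrixRep_cy : matrixRep cy = 4 := by
  rw [cy, matrixRep_algebraMap, eval_X]
  exact map_ofNat (algebraMap ℂ (Matrix (Fin 2) (Fin 2) ℂ)) 4

lemma matrixRep_gY : matrixRep gY = !![1, 0; 0, 0] := by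
  ext i j
  fin_cases i <;> fin_cases j <;> simp [matrixRep, gY]

lemma matrixRep_gZ : matrixRep gZ = !![0, 1; 0, 0] := by
  ext i j
  fin_cases i <;> fin_cases j <;> simp [matrixRep, gZ]

lemma matrixRep_gW : matrixRep gW = !![0, 0; 1, 0] := by
  ext i j
  fin_cases i <;> fin_cases j <;> simp [matrixRep, gW]

lemma matrixRep_smul (c : ℂ) (a : RAlg) : matrixRep (c • a) = c • matrixRep a := by
  have h : algebraMap ℂ RAlg c = algebraMap (MvPolynomial (Fin 2) ℂ) RAlg (C c) := rfl
  rw [Algebra.smul_def, map_mul, h, matrixRep_algebraMap, eval_C, Algebra.smul_def]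

lemma I2_le_ker_matrixRep : I2 ≤ TwoSidedIdeal.ker matrixRep := by
  refine TwoSidedIdeal.span_le.mpr ?_
  have four : (4 : Matrix (Fin 2) (Fin 2) ℂ) = !![4, 0; 0, 4] := by
    ext i j; fin_cases i <;> fin_cases j <;> simp [Matrix.ofNat_apply]
  have two : (2 : Matrix (Fin 2) (Fin 2) ℂ) = !![2, 0; 0, 2] := by
    ext i j; fin_cases i <;> fin_cases j <;> simp [Matrix.ofNat_apply]
  intro a ha
  simp only [Set.mem_insert_iff, Set.mem_singleton_iff] at ha
  rw [SetLike.mem_coe, TwoSidedIdeal.mem_ker]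
  rcases ha with rfl | rfl | rfl | rfl | rfl | rfl | rfl | rfl | rfl | rfl | rfl | rfl | rfl <;>
    simp only [map_add, map_sub, map_mul, map_pow, map_ofNat, matrixRep_smul, matrixRep_cx,
      matrixRep_cy, matrixRep_gY, matrixRep_gZ, matrixRep_gW, four, two] <;>
    ext i j <;> fin_cases i <;> fin_cases j <;>
    norm_num [pow_two, Matrix.mul_apply, Fin.sum_univ_two]

/-- The quotient algebra `R/I₂` is not commutative. -/
theorem stmt_14 :
    ¬ ∀ a b : I2.ringCon.Quotient, a * b = b * a := by
  intro h
  have hYZ : I2.ringCon (gY * gZ) (gZ * gY) :=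
    I2.ringCon.eq.mp (h (gY : I2.ringCon.Quotient) (gZ : I2.ringCon.Quotient))
  have hmem := I2_le_ker_matrixRep ((TwoSidedIdeal.rel_iff _ _ _).mp hYZ)
  rw [TwoSidedIdeal.mem_ker, map_sub, map_mul, map_mul, matrixRep_gY, matrixRep_gZ] at hmem
  simpa using congrFun (congrFun hmem 0) 1
end
end

section
/- For all natural numbers n and all integers i ≥ 1, the alternating sum ∑_{m=0}^{n} (−1)^m · C(m+n, n) · C(i+n, m+n) equals (−1)^n · C(i+n, n) · C(i−1, n) as integers; in particular, this sum is zero if and only if i ≤ n. -/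
/-- For all natural numbers `n` and all integers `i ≥ 1`,
`∑_{m=0}^{n} (−1)^m · C(m+n, n) · C(i+n, m+n) = (−1)^n · C(i+n, n) · C(i−1, n)`
as integers; in particular, this sum is zero if and only if `i ≤ n`. -/
theorem stmt_15 (n i : ℕ) (hi : 1 ≤ i) :
    (∑ m ∈ Finset.range (n + 1),
        (-1 : ℤ) ^ m * (m + n).choose n * (i + n).choose (m + n)) =
      (-1 : ℤ) ^ n * (i + n).choose n * (i - 1).choose n ∧
    ((∑ m ∈ Finset.range (n + 1),
        (-1 : ℤ) ^ m * (m + n).choose n * (i + n).choose (m + n)) = 0 ↔ i ≤ n) := by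
  have key : (∑ m ∈ Finset.range (n + 1),
        (-1 : ℤ) ^ m * (m + n).choose n * (i + n).choose (m + n)) =
      (-1 : ℤ) ^ n * (i + n).choose n * (i - 1).choose n := by
    obtain ⟨j, rfl⟩ := Nat.exists_eq_add_of_le' hi
    rw [Nat.add_sub_cancel, mul_right_comm, ← Int.alternating_sum_range_choose_eq_choose,
      Finset.sum_mul]
    refine Finset.sum_congr rfl fun m _ => ?_
    have h := Nat.choose_mul (n := j + 1 + n) (Nat.le_add_left n m)
    rw [Nat.add_sub_cancel, Nat.add_sub_cancel] at h
    zify at h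
    linear_combination (-1 : ℤ) ^ m * h
  refine ⟨key, ?_⟩
  have hne : (i + n).choose n ≠ 0 := (Nat.choose_pos (Nat.le_add_left n i)).ne'
  rw [key]
  simp only [mul_eq_zero, pow_eq_zero_iff', neg_eq_zero, one_ne_zero, false_and, false_or,
    Nat.cast_eq_zero, hne, Nat.choose_eq_zero_iff]
  omega
end
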